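/- Let Γ be an even unimodular positive definite lattice of rank 24 that contains a primitive sublattice isometric to P(−1). Then the sublattice of Γ generated by its roots (the vectors v ∈ Γ with ⟨v,v⟩ = 2) is isometric to the orthogonal direct sum of twelve copies of the A₂ root lattice; consequently Γ is isometric to the Niemeier lattice of type A₂¹². -/

import Mathlib

noncomputable section

abbrev F3 : Type := ZMod 3 × ZMod 3
abbrev IP : Type := F3 × Fin 2
abbrev VP : Type := IP → ℚ

/-- The basis vectors `E_t^(k)` (with `k : Fin 2` corresponding to `k+1 ∈ {1,2}`). -/
def Ev (t : F3) (k : Fin 2) : VP := Pi.single (t, k) 1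

/-- Gram coefficients of the bilinear form on `V`. -/
def GP : IP → IP → ℚ := fun i j =>
  if i.1 = j.1 then (if i.2 = j.2 then -2 else 1) else 0

/-- The symmetric bilinear form on `V`. -/
def BP (x y : VP) : ℚ := ∑ i : IP, ∑ j : IP, x i * GP i j * y j

lemma BP_add_left (a b x : VP) : BP (a + b) x = BP a x + BP b x := by
  simp only [BP, Pi.add_apply, add_mul, Finset.sum_add_distrib]

lemma BP_zsmul_left (c : ℤ) (a x : VP) : BP (c • a) x = c * BP a x := by
  simp only [BP, Pi.smul_apply, zsmul_eq_mul, Finset.mul_sum, mul_assoc]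

lemma BP_zero_left (x : VP) : BP 0 x = 0 := by
  simp [BP]

/-- `E_t := E_t^(1) + 2·E_t^(2)`. -/
def EV (t : F3) : VP := Ev t 0 + 2 • Ev t 1

/-- The affine line in `𝔽₃²` through `p` with direction `d`. -/
def lineF (p d : F3) : Finset F3 := Finset.image (fun s : ZMod 3 => p + s • d) Finset.univ

def IsLine (L : Finset F3) : Prop := ∃ p d : F3, d ≠ 0 ∧ L = lineF p d

def AreParallel (L L' : Finset F3) : Prop :=
  ∃ p p' d : F3, d ≠ 0 ∧ L = lineF p d ∧ L' = lineF p' d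

/-- `e(L) := (1/3)·∑_{t∈L} E_t`. -/
def eL (L : Finset F3) : VP := (3 : ℚ)⁻¹ • ∑ t ∈ L, EV t

/-- Generators of the root lattice `R` of type `A₂⁹`. -/
def Rgen : Set VP := {x | ∃ t k, x = Ev t k}

/-- The root lattice `R`. -/
def Rlat : Submodule ℤ VP := Submodule.span ℤ Rgen

/-- The lattice `P`. -/
def Plat : Submodule ℤ VP :=
  Submodule.span ℤ (Rgen ∪ {x | ∃ L L', AreParallel L L' ∧ x = eL L - eL L'})

/-- The dual lattice `Λ* = {v | ⟨v,λ⟩ ∈ ℤ for all λ ∈ Λ}`. -/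
def dualP (Λ : Submodule ℤ VP) : Submodule ℤ VP where
  carrier := {v | ∀ x ∈ Λ, ∃ n : ℤ, BP v x = n}
  zero_mem' := fun x _ => ⟨0, by simp [BP_zero_left]⟩
  add_mem' := by
    intro a b ha hb x hx
    obtain ⟨n, hn⟩ := ha x hx
    obtain ⟨m, hm⟩ := hb x hx
    exact ⟨n + m, by rw [BP_add_left, hn, hm]; push_cast; ring⟩
  smul_mem' := by
    intro c v hv x hx
    obtain ⟨n, hn⟩ := hv x hx
    exact ⟨c * n, by rw [BP_zsmul_left, hn]; push_cast; ring⟩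

def L12 : Finset F3 := lineF (0, 0) (0, 1)
def L34 : Finset F3 := lineF (0, 0) (1, 0)
def L00 : Finset F3 := lineF (0, 0) (1, 1)

def p1 : VP := eL L34 + eL L00
def p2 : VP := eL L12 + eL L34
def p3 : VP := eL L12 + eL L00

def pv : Fin 3 → VP := ![p1, p2, p3]


abbrev JN : Type := Fin 12 × Fin 2
abbrev WN : Type := JN → ℚ

/-- The simple roots `Ẽ_j^(k)` (with `k : Fin 2` corresponding to `k+1 ∈ {1,2}`). -/
def Et (j : Fin 12) (k : Fin 2) : WN := Pi.single (j, k) 1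

/-- Gram coefficients of the (positive definite) bilinear form on `W`. -/
def GN : JN → JN → ℚ := fun i j =>
  if i.1 = j.1 then (if i.2 = j.2 then 2 else -1) else 0

/-- The symmetric bilinear form on `W`. -/
def BW (x y : WN) : ℚ := ∑ i : JN, ∑ j : JN, x i * GN i j * y j

/-- `Ẽ_j := Ẽ_j^(1) + 2·Ẽ_j^(2)`. -/
def EtV (j : Fin 12) : WN := Et j 0 + 2 • Et j 1

/-- The rows of the generating matrix of the glue code. -/
def glueMat : Fin 6 → Fin 12 → ℚ :=
  ![![0, 1, 1, 1, 1, 1, 1, 0, 0, 0, 0, 0],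
    ![-1, 0, 1, -1, -1, 1, 0, 1, 0, 0, 0, 0],
    ![-1, 1, 0, 1, -1, -1, 0, 0, 1, 0, 0, 0],
    ![-1, -1, 1, 0, 1, -1, 0, 0, 0, 1, 0, 0],
    ![-1, -1, -1, 1, 0, 1, 0, 0, 0, 0, 1, 0],
    ![-1, 1, -1, -1, 1, 0, 0, 0, 0, 0, 0, 1]]

/-- The glue vectors `w_i := (1/3)·∑_j a_{ij}·Ẽ_j`. -/
def wvec (i : Fin 6) : WN := (3 : ℚ)⁻¹ • ∑ j : Fin 12, glueMat i j • EtV j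

/-- The Niemeier lattice `N` of type `A₂¹²`. -/
def NL : Submodule ℤ WN :=
  Submodule.span ℤ ({x | ∃ j k, x = Et j k} ∪ Set.range wvec)


/-! Section 1: reduction theory -/

structure PF {V : Type} [AddCommGroup V] (B : V → V → ℚ) : Prop where
  symm : ∀ x y, B x y = B y x
  add : ∀ x y z, B (x + y) z = B x z + B y z
  nonneg : ∀ x, 0 ≤ B x x

namespace PF

variable {V : Type} [AddCommGroup V] {B : V → V → ℚ}

lemma zsmul (h : PF B) (n : ℤ) (x y : V) : B (n • x) y = n * B x y := by
  have := map_zsmul (AddMonoidHom.mk' (fun x => B x y) (fun a b => h.add a b y)) n x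
  simpa using this

lemma add' (h : PF B) (x y z : V) : B x (y + z) = B x y + B x z := by
  rw [h.symm, h.add, h.symm y, h.symm z]

lemma zsmul' (h : PF B) (n : ℤ) (x y : V) : B x (n • y) = n * B x y := by
  rw [h.symm, h.zsmul, h.symm]

lemma neg (h : PF B) (x y : V) : B (-x) y = - B x y := by
  have := h.zsmul (-1) x y
  simpa using this

lemma neg' (h : PF B) (x y : V) : B x (-y) = - B x y := by
  rw [h.symm, h.neg, h.symm]

lemma sub (h : PF B) (x y z : V) : B (x - y) z = B x z - B y z := by
  rw [sub_eq_add_neg, h.add, h.neg]; ring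

lemma sub' (h : PF B) (x y z : V) : B x (y - z) = B x y - B x z := by
  rw [h.symm, h.sub, h.symm y, h.symm z]

lemma quad (h : PF B) (x v : V) (q : ℚ) : 0 ≤ B x x - 2 * q * B x v + q ^ 2 * B v v := by
  have h1 := h.nonneg ((q.den : ℤ) • x - q.num • v)
  rw [h.sub, h.sub', h.sub', h.zsmul, h.zsmul, h.zsmul, h.zsmul, h.zsmul', h.zsmul', h.zsmul',
    h.zsmul', h.symm v x] at h1
  have hd : (0 : ℚ) < q.den := by exact_mod_cast q.den_pos
  have hq : (q.num : ℚ) = q * q.den := (Rat.mul_den_eq_num q).symm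
  rw [hq] at h1
  push_cast at h1
  have h2 : 0 ≤ (q.den : ℚ) ^ 2 * (B x x - 2 * q * B x v + q ^ 2 * B v v) := by
    nlinarith
  exact nonneg_of_mul_nonneg_right h2 (by positivity)

lemma zero_of (h : PF B) {v : V} (hv : B v v = 0) (x : V) : B x v = 0 := by
  by_contra hne
  have := h.quad x v ((B x x + 1) / (2 * B x v))
  rw [hv] at this
  have e : 2 * ((B x x + 1) / (2 * B x v)) * B x v = B x x + 1 := by field_simp
  linarith

end PF

def sch {V : Type} (B : V → V → ℚ) (v x y : V) : ℚ := B x y - B x v * B y v / B v v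

lemma PF.sch {V : Type} [AddCommGroup V] {B : V → V → ℚ} (h : PF B) (v : V) : PF (sch B v) where
  symm x y := by unfold _root_.sch; rw [h.symm x y]; ring
  add x y z := by unfold _root_.sch; rw [h.add, h.add]; ring
  nonneg x := by
    unfold _root_.sch
    have := h.quad x v (B x v / B v v)
    by_cases hv : B v v = 0
    · simp [hv, h.nonneg]
    · have e : B x x - 2 * (B x v / B v v) * B x v + (B x v / B v v) ^ 2 * B v v
        = B x x - B x v * B x v / B v v := by field_simp; ring
      rwa [e] at this

def Disc {V : Type} [AddCommGroup V] (Λ : AddSubgroup V) (B : V → V → ℚ) : Prop :=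
  ∃ N : ℕ, 0 < N ∧ ∀ x ∈ Λ, ∀ y ∈ Λ, ∃ k : ℤ, N * B x y = k

lemma Disc.sch {V : Type} [AddCommGroup V] {Λ : AddSubgroup V} {B : V → V → ℚ} (h : PF B)
    (hd : Disc Λ B) {v : V} (hv : v ∈ Λ) : Disc Λ (sch B v) := by
  obtain ⟨N, hN, H⟩ := hd
  by_cases h0 : B v v = 0
  · refine ⟨N, hN, fun x hx y hy => ?_⟩
    simpa [_root_.sch, h0] using H x hx y hy
  · obtain ⟨k, hk⟩ := H v hv v hv
    have hNq : (0 : ℚ) < N := by exact_mod_cast hN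
    have hp : 0 < B v v := lt_of_le_of_ne (h.nonneg v) (Ne.symm h0)
    have hkpos : 0 < k := by
      have : (0 : ℚ) < k := by rw [← hk]; positivity
      exact_mod_cast this
    refine ⟨N * k.toNat, Nat.mul_pos hN (by omega), fun x hx y hy => ?_⟩
    obtain ⟨a, ha⟩ := H x hx y hy
    obtain ⟨b, hb⟩ := H x hx v hv
    obtain ⟨c, hc⟩ := H y hy v hv
    refine ⟨k * a - b * c, ?_⟩
    have hkn : ((k.toNat : ℕ) : ℚ) = (k : ℚ) := by
      have : ((k.toNat : ℕ) : ℤ) = k := Int.toNat_of_nonneg hkpos.le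
      exact_mod_cast this
    unfold _root_.sch
    push_cast
    rw [hkn, ← ha, ← hb, ← hc, ← hk]
    field_simp

def gd {V : Type} (B : V → V → ℚ) {n : ℕ} (z : Fin n → V) : ℚ :=
  Matrix.det (Matrix.of fun i j => B (z i) (z j))

lemma gd_congr {V W : Type} {B : V → V → ℚ} {C : W → W → ℚ} {n : ℕ} {z : Fin n → V}
    {w : Fin n → W} (h : ∀ i j, B (z i) (z j) = C (w i) (w j)) : gd B z = gd C w := by
  unfold gd; congr 1; ext i j; simp [h]

lemma gd_succ {V : Type} [AddCommGroup V] {B : V → V → ℚ} (h : PF B) {n : ℕ} (z : Fin (n+1) → V)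
    (h0 : B (z 0) (z 0) ≠ 0) :
    gd B z = B (z 0) (z 0) * gd (sch B (z 0)) (fun i => z (Fin.succ i)) := by
  unfold gd
  have key := Matrix.det_eq_of_forall_row_eq_smul_add_const
    (A := Matrix.of fun i j => B (z i) (z j))
    (B := Matrix.of fun i j => if i = 0 then B (z 0) (z j) else sch B (z 0) (z i) (z j))
    (fun i => if i = 0 then 0 else B (z i) (z 0) / B (z 0) (z 0)) 0 (by simp) (by
      intro i j
      by_cases hi : i = 0
      · simp [hi]
      · simp only [Matrix.of_apply, hi, if_false, if_true, sch]
        rw [h.symm (z j) (z 0)]; field_simp; ring)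
  rw [key, Matrix.det_succ_column_zero, Finset.sum_eq_single 0]
  · simp [Matrix.submatrix]
  · intro i _ hi
    simp [hi, sch, h0]
  · simp

def Red {V : Type} : (n : ℕ) → (V → V → ℚ) → (Fin n → V) → Prop
  | 0, _, _ => True
  | n+1, B, z => (∀ i : Fin n, |B (z i.succ) (z 0)| ≤ B (z 0) (z 0) / 2) ∧
      (∀ i : Fin n, i.val = 0 → B (z 0) (z 0) ≤ B (z i.succ) (z i.succ)) ∧
      Red n (sch B (z 0)) (fun i => z i.succ)

lemma Red_congr {V : Type} {n : ℕ} : ∀ {B C : V → V → ℚ} {z w : Fin n → V},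
    (∀ i j, B (z i) (z j) = C (w i) (w j)) → Red n B z → Red n C w := by
  induction n with
  | zero => intros; trivial
  | succ n ih =>
    intro B C z w h hr
    obtain ⟨h1, h2, h3⟩ := hr
    refine ⟨fun i => ?_, fun i hi => ?_, ih ?_ h3⟩
    · rw [← h, ← h]; exact h1 i
    · rw [← h, ← h]; exact h2 i hi
    · intro i j; simp only [sch, h]

lemma gd_pos_ne {V : Type} [AddCommGroup V] {B : V → V → ℚ} (h : PF B) {n : ℕ} (z : Fin (n+1) → V)
    (hg : 0 < gd B z) : 0 < B (z 0) (z 0) := by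
  rcases (h.nonneg (z 0)).lt_or_eq with h1 | h1
  · exact h1
  · exfalso
    have : gd B z = 0 := by
      unfold gd
      apply Matrix.det_eq_zero_of_column_eq_zero 0
      intro i
      simp [h.zero_of h1.symm]
    linarith

theorem LLL {V : Type} [AddCommGroup V] (Λ : AddSubgroup V) (n : ℕ) : ∀ (B : V → V → ℚ)
    (z : Fin n → V), PF B → Disc Λ B → (∀ i, z i ∈ Λ) → 0 < gd B z →
    ∃ z' : Fin n → V, (∀ i, z' i ∈ Λ) ∧ gd B z' = gd B z ∧ Red n B z' := by
  induction n with
  | zero => intro B z _ _ hz _; exact ⟨z, hz, rfl, trivial⟩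
  | succ n ih =>
    intro B z hB hD hz hg
    obtain ⟨N, hN, H⟩ := id hD
    have hNq : (0 : ℚ) < N := by exact_mod_cast hN
    let S : Set ℕ := {m | ∃ z' : Fin (n+1) → V, (∀ i, z' i ∈ Λ) ∧ gd B z' = gd B z ∧
      (N : ℚ) * B (z' 0) (z' 0) = m}
    have hval : ∀ z' : Fin (n+1) → V, (∀ i, z' i ∈ Λ) → gd B z' = gd B z →
        ∃ m ∈ S, (N : ℚ) * B (z' 0) (z' 0) = m := by
      intro z' hz' hg'
      obtain ⟨k, hk⟩ := H _ (hz' 0) _ (hz' 0)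
      have hk0 : 0 ≤ k := by
        have : (0 : ℚ) ≤ k := by rw [← hk]; exact mul_nonneg hNq.le (hB.nonneg _)
        exact_mod_cast this
      have hkn : ((k.toNat : ℕ) : ℚ) = (k : ℚ) := by
        have : ((k.toNat : ℕ) : ℤ) = k := Int.toNat_of_nonneg hk0
        exact_mod_cast this
      exact ⟨k.toNat, ⟨z', hz', hg', by rw [hk, hkn]⟩, by rw [hk, hkn]⟩
    have hS : S.Nonempty := by
      obtain ⟨m, hm, _⟩ := hval z hz rfl
      exact ⟨m, hm⟩
    obtain ⟨z1, hz1, hg1, hm1⟩ := Nat.sInf_mem hS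
    have hmin : ∀ z' : Fin (n+1) → V, (∀ i, z' i ∈ Λ) → gd B z' = gd B z →
        B (z1 0) (z1 0) ≤ B (z' 0) (z' 0) := by
      intro z' hz' hg'
      obtain ⟨m, hm, hm'⟩ := hval z' hz' hg'
      have h1 : (N : ℚ) * B (z1 0) (z1 0) ≤ N * B (z' 0) (z' 0) := by
        rw [hm1, hm']; exact_mod_cast Nat.sInf_le hm
      exact le_of_mul_le_mul_left h1 hNq
    have hp : 0 < B (z1 0) (z1 0) := gd_pos_ne hB z1 (by rw [hg1]; exact hg)
    have hgs := gd_succ hB z1 hp.ne'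
    have hgp : 0 < gd (sch B (z1 0)) (fun i => z1 (Fin.succ i)) := by
      rw [hg1] at hgs
      rw [hgs] at hg
      exact pos_of_mul_pos_right hg hp.le
    obtain ⟨z2, hz2, hg2, hr2⟩ := ih (sch B (z1 0)) (fun i => z1 (Fin.succ i)) (hB.sch _)
      (hD.sch hB (hz1 0)) (fun i => hz1 _) hgp
    set v := z1 0 with hv
    let z3 : Fin n → V := fun i => z2 i - round (B (z2 i) v / B v v) • v
    have hs3 : ∀ i j, sch B v (z2 i) (z2 j) = sch B v (z3 i) (z3 j) := by
      intro i j
      simp only [z3, sch, hB.sub, hB.sub', hB.zsmul, hB.zsmul', hB.symm v (z2 j)]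
      field_simp
      ring
    have hz3 : ∀ i, z3 i ∈ Λ := fun i => Λ.sub_mem (hz2 i) (Λ.zsmul_mem (hz1 0) _)
    let z4 : Fin (n+1) → V := Fin.cons v z3
    have hz4 : ∀ i, z4 i ∈ Λ := by
      intro i
      refine Fin.cases ?_ (fun j => ?_) i
      · exact hz1 0
      · exact hz3 j
    have hg4 : gd B z4 = gd B z := by
      rw [gd_succ hB z4 hp.ne', ← hg1, hgs, ← hg2]
      congr 1
      exact (gd_congr hs3).symm
    refine ⟨z4, hz4, hg4, ?_, ?_, ?_⟩
    · intro i
      show |B (z3 i) v| ≤ B v v / 2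
      simp only [z3, hB.sub, hB.zsmul]
      have h1 := abs_sub_round (B (z2 i) v / B v v)
      have e : B (z2 i) v - round (B (z2 i) v / B v v) * B v v =
        (B (z2 i) v / B v v - round (B (z2 i) v / B v v)) * B v v := by field_simp
      rw [e, abs_mul, abs_of_pos hp]
      nlinarith
    · intro i hi
      show B v v ≤ B (z4 i.succ) (z4 i.succ)
      have := hmin (z4 ∘ Equiv.swap 0 i.succ) (fun _ => hz4 _) (by
        rw [← hg4]
        unfold gd
        rw [← Matrix.det_submatrix_equiv_self (Equiv.swap 0 i.succ)
          (Matrix.of fun i j => B (z4 i) (z4 j))]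
        rfl)
      simpa using this
    · exact Red_congr hs3 hr2

lemma HB {V : Type} [AddCommGroup V] (n : ℕ) : ∀ (B : V → V → ℚ) (z : Fin (n+1) → V), PF B →
    0 < gd B z → Red (n+1) B z →
    B (z 0) (z 0) ^ (n+1) * (3/4) ^ ((n+1).choose 2) ≤ gd B z := by
  induction n with
  | zero =>
    intro B z hB hg _
    simp [gd]
  | succ n ih =>
    intro B z hB hg hr
    have hp := gd_pos_ne hB z hg
    have hgs := gd_succ hB z hp.ne'
    have hgp : 0 < gd (sch B (z 0)) (fun i => z (Fin.succ i)) := by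
      rw [hgs] at hg
      exact pos_of_mul_pos_right hg hp.le
    obtain ⟨h1, h2, h3⟩ := hr
    have := ih _ _ (hB.sch (z 0)) hgp h3
    rw [hgs]
    have h10 := h1 0
    have h20 := h2 0 rfl
    set d := B (z 0) (z 0)
    have hd : 3 / 4 * d ≤ sch B (z 0) (z (Fin.succ 0)) (z (Fin.succ 0)) := by
      unfold sch
      have h4 : B (z (Fin.succ 0)) (z 0) * B (z (Fin.succ 0)) (z 0) ≤ d * d / 4 := by
        rw [← abs_mul_abs_self]
        nlinarith [abs_nonneg (B (z (Fin.succ 0)) (z 0))]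
      have h5 : B (z (Fin.succ 0)) (z 0) * B (z (Fin.succ 0)) (z 0) / d ≤ d / 4 := by
        rw [div_le_iff₀ hp]; linarith
      linarith
    have h6 : (3 / 4 * d) ^ (n+1) * (3/4) ^ ((n+1).choose 2) ≤
        gd (sch B (z 0)) (fun i => z (Fin.succ i)) := by
      refine le_trans ?_ this
      gcongr
    have e : (n + 1 + 1).choose 2 = (n+1) + (n+1).choose 2 := by
      rw [Nat.choose_succ_succ' (n+1) 1]; simp
    calc d ^ (n+1+1) * (3/4) ^ ((n+1+1).choose 2) 
        = d * ((3 / 4 * d) ^ (n+1) * (3/4) ^ ((n+1).choose 2)) := by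
          rw [e, pow_add, mul_pow]; ring
      _ ≤ _ := by gcongr

/-! Section 2: finding hexagonal pairs -/

structure LatH {V : Type} [AddCommGroup V] (Λ : AddSubgroup V) (B : V → V → ℚ) : Prop where
  pf : PF B
  int : ∀ x ∈ Λ, ∀ y ∈ Λ, ∃ k : ℤ, B x y = k
  even : ∀ x ∈ Λ, ∃ k : ℤ, B x x = 2 * k
  no4 : ∀ a ∈ Λ, ∀ b ∈ Λ, ∀ c ∈ Λ, ∀ d ∈ Λ, B a a = 2 → B b b = 2 → B c c = 2 → B d d = 2 →
    B b a = 0 → B c a = 0 → B c b = 0 → B d a = 0 → B d b = 0 → B d c = 0 → False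
  cong : ∀ x ∈ Λ, ∀ y ∈ Λ, B x x = 2 → B y y = 2 → B x y = -1 →
    ∀ w ∈ Λ, ∃ k : ℤ, B w x - B w y = 3 * k

lemma small_int {x : ℚ} (h : ∃ k : ℤ, x = k) (hx : |x| ≤ 2 / 2) : x = 0 ∨ x = 1 ∨ x = -1 := by
  obtain ⟨k, rfl⟩ := h
  rw [abs_le] at hx
  have h1 : (-1 : ℤ) ≤ k := by
    have : ((-1 : ℤ) : ℚ) ≤ k := by push_cast; linarith [hx.1]
    exact_mod_cast this
  have h2 : k ≤ 1 := by
    have : (k : ℚ) ≤ (1 : ℤ) := by push_cast; linarith [hx.2]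
    exact_mod_cast this
  have : k = 0 ∨ k = 1 ∨ k = -1 := by omega
  rcases this with rfl | rfl | rfl <;> simp

lemma evn_two {x : ℚ} (h : ∃ k : ℤ, x = 2 * k) (hx : 0 < x) (hx' : x < 4) : x = 2 := by
  obtain ⟨k, rfl⟩ := h
  have h1 : 0 < k := by
    have : (0 : ℚ) < k := by linarith
    exact_mod_cast this
  have h2 : k < 2 := by
    have : (k : ℚ) < (2 : ℤ) := by push_cast; linarith
    exact_mod_cast this
  have : k = 1 := by omega
  subst this; simp

lemma pow_bd {d c q δ : ℚ} {n : ℕ} (hc : 0 ≤ c) (hq : 0 < q) (h : d ^ n * q ≤ δ)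
    (h' : δ < c ^ n * q) : d < c := by
  have : d ^ n < c ^ n := lt_of_mul_lt_mul_right (lt_of_le_of_lt h h') hq.le
  exact lt_of_pow_lt_pow_left₀ n hc this

def HexAt {V : Type} (B : V → V → ℚ) {n : ℕ} (z : Fin n → V) : Prop :=
  ∃ i j, i ≠ j ∧ B (z i) (z i) = 2 ∧ B (z j) (z j) = 2 ∧ (B (z i) (z j) = 1 ∨ B (z i) (z j) = -1)

lemma hexA {V : Type} [AddCommGroup V] {Λ : AddSubgroup V} {B : V → V → ℚ} (H : LatH Λ B)
    (m : ℕ) (δ : ℚ) (z : Fin (m+4) → V) (hz : ∀ i, z i ∈ Λ) (hδ : 0 < δ) (hg : gd B z = δ)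
    (hr : Red (m+4) B z)
    (c0 : δ < 4 ^ (m+4) * (3/4) ^ ((m+4).choose 2))
    (c1 : δ / 2 < (7/2) ^ (m+3) * (3/4) ^ ((m+3).choose 2))
    (c2 : δ / 4 < 3 ^ (m+2) * (3/4) ^ ((m+2).choose 2))
    (c3 : δ / 8 < (5/2) ^ (m+1) * (3/4) ^ ((m+1).choose 2)) : HexAt B z := by
  by_contra hno
  have hB := H.pf
  have hno' : ∀ i j, i ≠ j → B (z i) (z i) = 2 → B (z j) (z j) = 2 →
      (B (z i) (z j) = 0 ∨ B (z i) (z j) = 1 ∨ B (z i) (z j) = -1) → B (z i) (z j) = 0 := by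
    intro i j hij hi hj h
    rcases h with h | h | h
    · exact h
    · exact absurd ⟨i, j, hij, hi, hj, Or.inl h⟩ hno
    · exact absurd ⟨i, j, hij, hi, hj, Or.inr h⟩ hno
  -- step 0
  have hb0 := HB (m+3) B z hB (hg ▸ hδ) hr
  have hp0 := gd_pos_ne hB z (hg ▸ hδ)
  have hg0 := gd_succ hB z hp0.ne'
  obtain ⟨r0, -, hr⟩ := hr
  rw [hg] at hb0 hg0
  have e0 : B (z 0) (z 0) = 2 :=
    evn_two (H.even _ (hz 0)) hp0 (pow_bd (by norm_num) (by positivity) hb0 c0)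
  rw [e0] at hg0 r0
  -- step 1
  set a0 := z 0 with ha0
  set a1 := z (Fin.succ 0) with ha1
  set a2 := z (Fin.succ (Fin.succ 0)) with ha2
  set a3 := z (Fin.succ (Fin.succ (Fin.succ 0))) with ha3
  have hz0 : a0 ∈ Λ := hz _
  have hz1 : a1 ∈ Λ := hz _
  have hz2 : a2 ∈ Λ := hz _
  have hz3 : a3 ∈ Λ := hz _
  have n10 : (Fin.succ 0 : Fin (m+4)) ≠ 0 := Fin.succ_ne_zero _
  have n20 : (Fin.succ (Fin.succ 0) : Fin (m+4)) ≠ 0 := Fin.succ_ne_zero _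
  have n30 : (Fin.succ (Fin.succ (Fin.succ 0)) : Fin (m+4)) ≠ 0 := Fin.succ_ne_zero _
  have n21 : (Fin.succ (Fin.succ 0) : Fin (m+4)) ≠ Fin.succ 0 := by
    intro h; exact Fin.succ_ne_zero _ (Fin.succ_injective _ h)
  have n31 : (Fin.succ (Fin.succ (Fin.succ 0)) : Fin (m+4)) ≠ Fin.succ 0 := by
    intro h; exact Fin.succ_ne_zero _ (Fin.succ_injective _ h)
  have n32 : (Fin.succ (Fin.succ (Fin.succ 0)) : Fin (m+4)) ≠ Fin.succ (Fin.succ 0) := by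
    intro h; exact Fin.succ_ne_zero _ (Fin.succ_injective _ (Fin.succ_injective _ h))
  have hg1' : gd (sch B a0) (fun i => z (Fin.succ i)) = δ / 2 := by linarith
  have hB1 := hB.sch a0
  have hd1 : 0 < gd (sch B a0) (fun i => z (Fin.succ i)) := by rw [hg1']; linarith
  have hb1 := HB (m+2) _ _ hB1 hd1 hr
  have hp1 := gd_pos_ne hB1 _ hd1
  have hg1 := gd_succ hB1 (fun i => z (Fin.succ i)) hp1.ne'
  obtain ⟨r1, -, hr⟩ := hr
  rw [hg1'] at hb1 hg1
  have l1 := pow_bd (by norm_num) (by positivity) hb1 c1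
  change 0 < sch B a0 a1 a1 at hp1
  change sch B a0 a1 a1 < 7 / 2 at l1
  change δ / 2 = sch B a0 a1 a1 * gd (sch (sch B a0) a1) (fun i => z (Fin.succ (Fin.succ i))) at hg1
  change Red (m+2) (sch (sch B a0) a1) (fun i => z (Fin.succ (Fin.succ i))) at hr
  have i10 : B a1 a0 = 0 ∨ B a1 a0 = 1 ∨ B a1 a0 = -1 := small_int (H.int _ hz1 _ hz0) (r0 0)
  have i20 : B a2 a0 = 0 ∨ B a2 a0 = 1 ∨ B a2 a0 = -1 :=
    small_int (H.int _ hz2 _ hz0) (r0 (Fin.succ 0))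
  have i30 : B a3 a0 = 0 ∨ B a3 a0 = 1 ∨ B a3 a0 = -1 :=
    small_int (H.int _ hz3 _ hz0) (r0 (Fin.succ (Fin.succ 0)))
  have e1 : B a1 a1 = 2 := by
    unfold sch at l1 hp1; rw [e0] at l1 hp1
    apply evn_two (H.even _ hz1) <;> rcases i10 with h | h | h <;> rw [h] at l1 hp1 <;> linarith
  have o10 : B a1 a0 = 0 := hno' _ _ n10 e1 e0 i10
  have s1 : ∀ x, sch B a0 x a1 = B x a1 := by intro x; simp [sch, o10]
  rw [s1, e1] at hg1
  -- step 2
  have hg2' : gd (sch (sch B a0) a1) (fun i => z (Fin.succ (Fin.succ i))) = δ / 4 := by linarith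
  have hB2 := hB1.sch a1
  have hd2 : 0 < gd (sch (sch B a0) a1) (fun i => z (Fin.succ (Fin.succ i))) := by
    rw [hg2']; linarith
  have hb2 := HB (m+1) _ _ hB2 hd2 hr
  have hp2 := gd_pos_ne hB2 _ hd2
  have hg2 := gd_succ hB2 (fun i => z (Fin.succ (Fin.succ i))) hp2.ne'
  obtain ⟨r2, -, hr⟩ := hr
  rw [hg2'] at hb2 hg2
  have l2 := pow_bd (by norm_num) (by positivity) hb2 c2
  change 0 < sch (sch B a0) a1 a2 a2 at hp2
  change sch (sch B a0) a1 a2 a2 < 3 at l2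
  change δ / 4 = sch (sch B a0) a1 a2 a2 * gd (sch (sch (sch B a0) a1) a2)
    (fun i => z (Fin.succ (Fin.succ (Fin.succ i)))) at hg2
  change Red (m+1) (sch (sch (sch B a0) a1) a2)
    (fun i => z (Fin.succ (Fin.succ (Fin.succ i)))) at hr
  have i21 : B a2 a1 = 0 ∨ B a2 a1 = 1 ∨ B a2 a1 = -1 := by
    refine small_int (H.int _ hz2 _ hz1) ?_
    have : |sch B a0 a2 a1| ≤ sch B a0 a1 a1 / 2 := r1 0
    rwa [s1, s1, e1] at this
  have i31 : B a3 a1 = 0 ∨ B a3 a1 = 1 ∨ B a3 a1 = -1 := by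
    refine small_int (H.int _ hz3 _ hz1) ?_
    have : |sch B a0 a3 a1| ≤ sch B a0 a1 a1 / 2 := r1 (Fin.succ 0)
    rwa [s1, s1, e1] at this
  have t2 : ∀ x y, sch (sch B a0) a1 x y = B x y - B x a0 * B y a0 / 2 - B x a1 * B y a1 / 2 := by
    intro x y; unfold sch; rw [o10, e0, e1]; ring
  have e2 : B a2 a2 = 2 := by
    rw [t2] at l2 hp2
    apply evn_two (H.even _ hz2) <;> rcases i20 with h | h | h <;> rw [h] at l2 hp2 <;>
      rcases i21 with h' | h' | h' <;> rw [h'] at l2 hp2 <;> linarith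
  have o20 : B a2 a0 = 0 := hno' _ _ n20 e2 e0 i20
  have o21 : B a2 a1 = 0 := hno' _ _ n21 e2 e1 i21
  have s2 : ∀ x, sch (sch B a0) a1 x a2 = B x a2 := by intro x; rw [t2, o20, o21]; ring
  rw [s2, e2] at hg2
  -- step 3
  have hg3' : gd (sch (sch (sch B a0) a1) a2) (fun i => z (Fin.succ (Fin.succ (Fin.succ i))))
    = δ / 8 := by linarith
  have hB3 := hB2.sch a2
  have hd3 : 0 < gd (sch (sch (sch B a0) a1) a2)
      (fun i => z (Fin.succ (Fin.succ (Fin.succ i)))) := by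
    rw [hg3']; linarith
  have hb3 := HB m _ _ hB3 hd3 hr
  have hp3 := gd_pos_ne hB3 _ hd3
  rw [hg3'] at hb3
  have l3 := pow_bd (by norm_num) (by positivity) hb3 c3
  change 0 < sch (sch (sch B a0) a1) a2 a3 a3 at hp3
  change sch (sch (sch B a0) a1) a2 a3 a3 < 5 / 2 at l3
  have i32 : B a3 a2 = 0 ∨ B a3 a2 = 1 ∨ B a3 a2 = -1 := by
    refine small_int (H.int _ hz3 _ hz2) ?_
    have : |sch (sch B a0) a1 a3 a2| ≤ sch (sch B a0) a1 a2 a2 / 2 := r2 0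
    rwa [s2, s2, e2] at this
  have t3 : sch (sch (sch B a0) a1) a2 a3 a3 = B a3 a3 - B a3 a0 * B a3 a0 / 2
      - B a3 a1 * B a3 a1 / 2 - B a3 a2 * B a3 a2 / 2 := by
    rw [sch, t2, s2, s2, e2]
  have e3 : B a3 a3 = 2 := by
    rw [t3] at l3 hp3
    apply evn_two (H.even _ hz3) <;> rcases i30 with h | h | h <;> rw [h] at l3 hp3 <;>
      rcases i31 with h' | h' | h' <;> rw [h'] at l3 hp3 <;>
      rcases i32 with h'' | h'' | h'' <;> rw [h''] at l3 hp3 <;> linarith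
  exact H.no4 a0 hz0 a1 hz1 a2 hz2 a3 hz3 e0 e1 e2 e3 o10 o20 o21
    (hno' _ _ n30 e3 e0 i30) (hno' _ _ n31 e3 e1 i31) (hno' _ _ n32 e3 e2 i32)

lemma hexB {V : Type} [AddCommGroup V] {Λ : AddSubgroup V} {B : V → V → ℚ} (H : LatH Λ B)
    (z : Fin 2 → V) (hz : ∀ i, z i ∈ Λ) (hg : gd B z = 3)
    (hr : Red 2 B z) : HexAt B z := by
  have hB := H.pf
  have hδ : (0 : ℚ) < gd B z := by rw [hg]; norm_num
  have hb0 := HB 1 B z hB hδ hr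
  have hp0 := gd_pos_ne hB z hδ
  obtain ⟨r0, -, hr⟩ := hr
  rw [hg] at hb0
  have e0 : B (z 0) (z 0) = 2 :=
    evn_two (H.even _ (hz 0)) hp0
      (pow_bd (by norm_num) (by positivity) hb0 (by norm_num [Nat.choose]))
  have i10 : B (z 1) (z 0) = 0 ∨ B (z 1) (z 0) = 1 ∨ B (z 1) (z 0) = -1 :=
    small_int (H.int _ (hz 1) _ (hz 0)) (by have := r0 0; rwa [e0] at this)
  have hd : B (z 0) (z 0) * B (z 1) (z 1) - B (z 1) (z 0) * B (z 1) (z 0) = 3 := by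
    rw [← hg, gd, Matrix.det_fin_two]; simp [hB.symm (z 0) (z 1)]
  rw [e0] at hd
  obtain ⟨k, hk⟩ := H.even _ (hz 1)
  rcases i10 with h | h | h
  · exfalso
    rw [h, hk] at hd
    have : (4 * k : ℤ) = 3 := by
      have : ((4 * k : ℤ) : ℚ) = (3 : ℤ) := by push_cast; linarith
      exact_mod_cast this
    omega
  · rw [h] at hd
    exact ⟨1, 0, by simp, by linarith, e0, Or.inl h⟩
  · rw [h] at hd
    exact ⟨1, 0, by simp, by linarith, e0, Or.inr h⟩

lemma hexSplit {V : Type} [AddCommGroup V] {Λ : AddSubgroup V} {B : V → V → ℚ} (H : LatH Λ B)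
    (n : ℕ) (z : Fin (n+2) → V) (hz : ∀ i, z i ∈ Λ) (hx : HexAt B z) :
    ∃ x ∈ Λ, ∃ y ∈ Λ, B x x = 2 ∧ B y y = 2 ∧ B x y = -1 ∧ ∃ w : Fin n → V,
      (∀ i, w i ∈ Λ ∧ B (w i) x = 0 ∧ B (w i) y = 0) ∧ gd B w = gd B z / 3 := by
  have hB := H.pf
  obtain ⟨i, j, hij, hi, hj, hs⟩ := hx
  obtain ⟨σ, h0, h1⟩ : ∃ σ : Equiv.Perm (Fin (n+2)), σ 0 = i ∧ σ 1 = j := by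
    refine ⟨Equiv.swap 0 i * Equiv.swap 1 (Equiv.swap 0 i j), ?_, ?_⟩
    · have hne : (0 : Fin (n+2)) ≠ Equiv.swap 0 i j := by
        intro h
        have := congrArg (Equiv.swap 0 i) h
        rw [Equiv.swap_apply_left, Equiv.swap_apply_self] at this
        exact hij this
      rw [Equiv.Perm.mul_apply, Equiv.swap_apply_of_ne_of_ne (by simp) hne]
      simp
    · simp
  obtain ⟨z', rfl⟩ : ∃ z' : Fin (n+2) → V, z = z' ∘ σ.symm := ⟨z ∘ σ, by ext; simp⟩
  have hgz : gd B (z' ∘ σ.symm) = gd B z' := by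
    unfold gd
    rw [← Matrix.det_submatrix_equiv_self σ.symm (Matrix.of fun i j => B (z' i) (z' j))]
    rfl
  have hz' : ∀ i, z' i ∈ Λ := fun i => by have := hz (σ i); simpa using this
  simp only [Function.comp, ← h0, ← h1, Equiv.symm_apply_apply] at hi hj hs
  rw [hgz]
  have hs1 : (1 : Fin (n+2)) = Fin.succ 0 := rfl
  have hq : sch B (z' 0) (z' 1) (z' 1) = 3 / 2 := by
    unfold sch
    rw [hi, hj, hB.symm (z' 1) (z' 0)]
    rcases hs with h | h <;> rw [h] <;> norm_num
  have hgd : gd B z' = 3 * gd (sch (sch B (z' 0)) (z' 1)) (fun i => z' i.succ.succ) := by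
    rw [gd_succ hB z' (by rw [hi]; norm_num), gd_succ (hB.sch _) _ (by
      show sch B (z' 0) (z' 1) (z' 1) ≠ 0
      rw [hq]; norm_num)]
    change B (z' 0) (z' 0) * (sch B (z' 0) (z' 1) (z' 1) *
      gd (sch (sch B (z' 0)) (z' 1)) (fun i => z' i.succ.succ)) = _
    rw [hq, hi]; ring
  obtain ⟨s, hs2, y, hy, hyd⟩ : ∃ s : ℚ, s ^ 2 = 1 ∧ ∃ y ∈ Λ, (∀ w, B w y = s * B w (z' 1)) ∧
      B (z' 0) (z' 1) = - s ∧ B (z' 0) y = -1 ∧ B y y = 2 := by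
    rcases hs with h | h
    · exact ⟨-1, by norm_num, -z' 1, Λ.neg_mem (hz' 1), fun w => by rw [hB.neg']; ring, by
        rw [h]; norm_num, by rw [hB.neg', h], by rw [hB.neg', hB.neg, hj]; norm_num⟩
    · exact ⟨1, by norm_num, z' 1, hz' 1, fun w => by ring, h, h, hj⟩
  obtain ⟨hy1, hy2, hy3, hy4⟩ := hyd
  have hc := H.cong _ (hz' 0) _ hy hi hy4 hy3
  choose k hk using fun i : Fin n => hc _ (hz' i.succ.succ)
  choose q hq' using fun i : Fin n => H.int _ (hz' i.succ.succ) _ hy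
  refine ⟨z' 0, hz' 0, y, hy, hi, hy4, hy3,
    fun i => z' i.succ.succ - (2 * k i + q i) • z' 0 - (k i + q i) • y, ?_, ?_⟩
  · intro i
    refine ⟨Λ.sub_mem (Λ.sub_mem (hz' _) (Λ.zsmul_mem (hz' 0) _)) (Λ.zsmul_mem hy _), ?_, ?_⟩
    · have := hk i
      simp only [hB.sub, hB.zsmul, hi, hB.symm y, hy3]
      rw [hq' i] at this
      push_cast; linarith
    · simp only [hB.sub, hB.zsmul, hy4, hy3, hq' i]
      push_cast; ring
  · rw [hgd]
    rw [mul_div_cancel_left₀ _ (by norm_num : (3 : ℚ) ≠ 0)]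
    apply gd_congr
    intro i j
    have a1 := hk i
    have a2 := hk j
    have b1 := hq' i
    have b2 := hq' j
    have c1 := hy1 (z' i.succ.succ)
    have c2 := hy1 (z' j.succ.succ)
    have d1 : B (z' i.succ.succ) (z' 1) = s * B (z' i.succ.succ) y := by
      rw [c1, ← mul_assoc, ← sq, hs2, one_mul]
    have d2 : B (z' j.succ.succ) (z' 1) = s * B (z' j.succ.succ) y := by
      rw [c2, ← mul_assoc, ← sq, hs2, one_mul]
    rw [sch, hq]
    unfold sch
    rw [hB.symm (z' 1) (z' 0), hy2, hi, d1, d2]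
    simp only [hB.sub, hB.sub', hB.zsmul, hB.zsmul', hB.symm (z' 0) (z' _), hB.symm y (z' _), hi,
      hy3, hy4]
    have f1 : B (z' i.succ.succ) (z' 0) = 3 * k i + q i := by linarith
    have f2 : B (z' j.succ.succ) (z' 0) = 3 * k j + q j := by linarith
    rw [f1, f2, b1, b2]
    push_cast
    have hss : s * s = 1 := by rw [← sq, hs2]
    generalize (k i : ℚ) = ki
    generalize (k j : ℚ) = kj
    generalize (q i : ℚ) = qi
    generalize (q j : ℚ) = qj
    linear_combination (2/3) * (qi + (3*ki+qi)/2) * (qj + (3*kj+qj)/2) * hss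

lemma LatH.disc {V : Type} [AddCommGroup V] {Λ : AddSubgroup V} {B : V → V → ℚ} (H : LatH Λ B) :
    Disc Λ B := ⟨1, one_pos, fun x hx y hy => by simpa using H.int x hx y hy⟩

lemma LatH.mono {V : Type} [AddCommGroup V] {Λ Λ' : AddSubgroup V} {B : V → V → ℚ}
    (H : LatH Λ B) (h : Λ' ≤ Λ) : LatH Λ' B where
  pf := H.pf
  int x hx y hy := H.int x (h hx) y (h hy)
  even x hx := H.even x (h hx)
  no4 a ha b hb c hc d hd := H.no4 a (h ha) b (h hb) c (h hc) d (h hd)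
  cong x hx y hy h1 h2 h3 w hw := H.cong x (h hx) y (h hy) h1 h2 h3 w (h hw)

def orth {V : Type} [AddCommGroup V] {Λ : AddSubgroup V} {B : V → V → ℚ} (H : LatH Λ B) (x y : V) :
    AddSubgroup V where
  carrier := {v | v ∈ Λ ∧ B v x = 0 ∧ B v y = 0}
  zero_mem' := by
    have := H.pf.zsmul 0
    refine ⟨Λ.zero_mem, ?_, ?_⟩
    · simpa using this 0 x
    · simpa using this 0 y
  add_mem' := by
    rintro a b ⟨h1, h2, h3⟩ ⟨k1, k2, k3⟩
    exact ⟨Λ.add_mem h1 k1, by rw [H.pf.add, h2, k2, add_zero], by rw [H.pf.add, h3, k3, add_zero]⟩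
  neg_mem' := by
    rintro a ⟨h1, h2, h3⟩
    exact ⟨Λ.neg_mem h1, by rw [H.pf.neg, h2, neg_zero], by rw [H.pf.neg, h3, neg_zero]⟩

theorem threeHex {V : Type} [AddCommGroup V] {Λ : AddSubgroup V} {B : V → V → ℚ} (H : LatH Λ B)
    (z : Fin 6 → V) (hz : ∀ i, z i ∈ Λ) (hg : gd B z = 27) :
    ∃ x y : Fin 3 → V, (∀ i, x i ∈ Λ ∧ y i ∈ Λ ∧ B (x i) (x i) = 2 ∧ B (y i) (y i) = 2 ∧
      B (x i) (y i) = -1) ∧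
      ∀ i j, i ≠ j → B (x i) (x j) = 0 ∧ B (x i) (y j) = 0 ∧ B (y i) (x j) = 0 ∧
        B (y i) (y j) = 0 := by
  obtain ⟨z, hz, hg', hr⟩ := LLL Λ 6 B z H.pf H.disc hz (by rw [hg]; norm_num)
  rw [hg] at hg'
  have hx := hexA H 2 27 z hz (by norm_num) hg' hr (by norm_num [Nat.choose])
    (by norm_num [Nat.choose]) (by norm_num [Nat.choose]) (by norm_num [Nat.choose])
  obtain ⟨x1, hx1, y1, hy1, a1, a2, a3, w, hw, hgw⟩ := hexSplit H 4 z hz hx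
  rw [hg'] at hgw
  have hle1 : orth H x1 y1 ≤ Λ := fun v hv => hv.1
  have H1 := H.mono hle1
  obtain ⟨z, hz, hg', hr⟩ := LLL (orth H x1 y1) 4 B w H1.pf H1.disc hw (by rw [hgw]; norm_num)
  rw [hgw] at hg'
  have hx := hexA H1 0 9 z hz (by norm_num) (by rw [hg']; norm_num) hr (by norm_num [Nat.choose])
    (by norm_num [Nat.choose]) (by norm_num [Nat.choose]) (by norm_num [Nat.choose])
  obtain ⟨x2, hx2, y2, hy2, b1, b2, b3, w, hw, hgw⟩ := hexSplit H1 2 z hz hx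
  rw [hg'] at hgw
  have hle2 : orth H1 x2 y2 ≤ orth H x1 y1 := fun v hv => hv.1
  have H2 := H1.mono hle2
  obtain ⟨z, hz, hg', hr⟩ := LLL (orth H1 x2 y2) 2 B w H2.pf H2.disc hw (by rw [hgw]; norm_num)
  rw [hgw] at hg'
  have hx := hexB H2 z hz (by rw [hg']; norm_num) hr
  obtain ⟨x3, hx3, y3, hy3, c1, c2, c3, -⟩ := hexSplit H2 0 z hz hx
  obtain ⟨p1, p2, p3⟩ := hx2
  obtain ⟨q1, q2, q3⟩ := hy2
  obtain ⟨⟨r1, r2, r3⟩, r4, r5⟩ := hx3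
  obtain ⟨⟨s1, s2, s3⟩, s4, s5⟩ := hy3
  have sy := H.pf.symm
  refine ⟨![x1, x2, x3], ![y1, y2, y3], ?_, ?_⟩
  · intro i
    fin_cases i
    · exact ⟨hx1, hy1, a1, a2, a3⟩
    · exact ⟨p1, q1, b1, b2, b3⟩
    · exact ⟨r1, s1, c1, c2, c3⟩
  · intro i j hij
    fin_cases i <;> fin_cases j <;> first | (exact absurd rfl hij) | skip
    · exact ⟨(sy _ _).trans p2, (sy _ _).trans q2, (sy _ _).trans p3, (sy _ _).trans q3⟩
    · exact ⟨(sy _ _).trans r2, (sy _ _).trans s2, (sy _ _).trans r3, (sy _ _).trans s3⟩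
    · exact ⟨p2, p3, q2, q3⟩
    · exact ⟨(sy _ _).trans r4, (sy _ _).trans s4, (sy _ _).trans r5, (sy _ _).trans s5⟩
    · exact ⟨r2, r3, s2, s3⟩
    · exact ⟨r4, r5, s4, s5⟩

/-! Section 3: the lattice P -/

def sg (z : ZMod 3) : ℤ := if z = 0 then 0 else if z = 1 then 1 else -1

lemma sg_cast (z : ZMod 3) : ((sg z : ℤ) : ZMod 3) = z := by revert z; decide

def lfun (i : Fin 3) (t : F3) : ZMod 3 :=
  if i = 0 then 1 - t.1 - t.2 else if i = 1 then t.1 else t.2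

def ipt (i : Fin 3) : F3 := if i = 0 then (0, 0) else if i = 1 then (1, 0) else (0, 1)

lemma lfun_ipt (i j : Fin 3) : lfun i (ipt j) = if i = j then 1 else 0 := by
  revert i j; decide

lemma ipt_inj : Function.Injective ipt := by decide

def uline (i : Fin 3) : VP :=
  if i = 0 then eL (lineF (0,0) (1,2)) - eL (lineF (2,0) (1,2))
  else if i = 1 then eL (lineF (1,0) (0,1)) - eL (lineF (2,0) (0,1))
  else eL (lineF (0,1) (1,0)) - eL (lineF (0,2) (1,0))

lemma EV_apply (s t : F3) (k : Fin 2) :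
    EV s (t, k) = if s = t then (if k = 0 then 1 else 2) else 0 := by
  unfold EV Ev
  simp only [Pi.add_apply, Pi.smul_apply, Pi.single_apply, Prod.mk.injEq]
  by_cases h : s = t
  · subst h
    fin_cases k <;> simp
  · have h' : ¬ t = s := fun e => h e.symm
    simp [h, h']

lemma eL_apply (L : Finset F3) (t : F3) (k : Fin 2) :
    eL L (t, k) = if t ∈ L then (if k = 0 then 1 else 2) / 3 else 0 := by
  unfold eL
  simp only [Pi.smul_apply, Finset.sum_apply, EV_apply, Finset.sum_ite_eq', smul_eq_mul]
  split_ifs <;> ring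

lemma uline_apply (i : Fin 3) (t : F3) (k : Fin 2) :
    uline i (t, k) = sg (lfun i t) * (if k = 0 then 1 else 2) / 3 := by
  have h : ∀ (i : Fin 3) (t : F3), sg (lfun i t) =
      if i = 0 then (if t ∈ lineF (0,0) (1,2) then 1 else 0) -
        (if t ∈ lineF (2,0) (1,2) then 1 else 0)
      else if i = 1 then (if t ∈ lineF (1,0) (0,1) then 1 else 0) -
        (if t ∈ lineF (2,0) (0,1) then 1 else 0)
      else (if t ∈ lineF (0,1) (1,0) then 1 else 0) -
        (if t ∈ lineF (0,2) (1,0) then 1 else 0) := by decide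
  rw [h]
  unfold uline
  fin_cases i <;> simp [eL_apply] <;> split_ifs <;> norm_num

lemma uline_mem (i : Fin 3) : uline i ∈ Plat := by
  apply Submodule.subset_span
  right
  fin_cases i
  · exact ⟨_, _, ⟨_, _, (1,2), by decide, rfl, rfl⟩, rfl⟩
  · exact ⟨_, _, ⟨_, _, (0,1), by decide, rfl, rfl⟩, rfl⟩
  · exact ⟨_, _, ⟨_, _, (1,0), by decide, rfl, rfl⟩, rfl⟩

lemma Ev_mem (t : F3) (k : Fin 2) : Ev t k ∈ Plat :=
  Submodule.subset_span (Or.inl ⟨t, k, rfl⟩)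

def pb (p : IP) : VP :=
  if p = (ipt 0, 0) then uline 0 else if p = (ipt 1, 0) then uline 1
  else if p = (ipt 2, 0) then uline 2 else Ev p.1 p.2

lemma pb_ipt (i : Fin 3) : pb (ipt i, 0) = uline i := by
  fin_cases i
  · rfl
  · rw [pb, if_neg (by decide), if_pos (by rfl)]; rfl
  · rw [pb, if_neg (by decide), if_neg (by decide), if_pos (by rfl)]; rfl

lemma pb_other (p : IP) (h : ∀ i, p ≠ (ipt i, 0)) : pb p = Ev p.1 p.2 := by
  rw [pb, if_neg (h 0), if_neg (h 1), if_neg (h 2)]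

lemma pb_mem (p : IP) : pb p ∈ Plat := by
  by_cases h : ∃ i, p = (ipt i, 0)
  · obtain ⟨i, rfl⟩ := h
    rw [pb_ipt]; exact uline_mem i
  · push Not at h
    rw [pb_other p h]; exact Ev_mem _ _

def Aff (x : VP) : Prop := ∃ m n : F3 → ℤ,
  (∀ t, x (t, 0) = m t / 3 ∧ x (t, 1) = n t / 3 ∧ (n t : ZMod 3) = 2 * m t) ∧
  ∃ d e f : ZMod 3, ∀ t, (m t : ZMod 3) = d + e * t.1 + f * t.2

lemma uline_three (i : Fin 3) : (3 : ℤ) • uline i = ∑ s : F3, sg (lfun i s) • EV s := by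
  ext ⟨t, k⟩
  simp only [Pi.smul_apply, Finset.sum_apply]
  simp only [EV_apply, uline_apply, zsmul_eq_mul, mul_ite, mul_zero, Finset.sum_ite_eq', Finset.mem_univ, if_true]
  split_ifs <;> push_cast <;> ring

lemma Ev_span (t : F3) (k : Fin 2) : Ev t k ∈ Submodule.span ℤ (Set.range pb) := by
  have h1 : ∀ t, Ev t 1 ∈ Submodule.span ℤ (Set.range pb) := by
    intro t
    rw [← pb_other (t, 1) (by simp)]
    exact Submodule.subset_span ⟨_, rfl⟩
  have h0 : ∀ t, (∀ i, t ≠ ipt i) → Ev t 0 ∈ Submodule.span ℤ (Set.range pb) := by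
    intro t ht
    rw [← pb_other (t, 0) (by simpa using ht)]
    exact Submodule.subset_span ⟨_, rfl⟩
  have hu : ∀ i, uline i ∈ Submodule.span ℤ (Set.range pb) := by
    intro i
    rw [← pb_ipt]
    exact Submodule.subset_span ⟨_, rfl⟩
  fin_cases k
  · show Ev t 0 ∈ _
    by_cases h : ∃ i, t = ipt i
    · obtain ⟨i, rfl⟩ := h
      have e := uline_three i
      rw [← Finset.add_sum_erase _ _ (Finset.mem_univ (ipt i)), lfun_ipt, if_pos rfl] at e
      have e2 : Ev (ipt i) 0 = (3 : ℤ) • uline i - 2 • Ev (ipt i) 1 -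
          ∑ x ∈ Finset.univ.erase (ipt i), sg (lfun i x) • EV x := by
        rw [e, EV, show sg 1 = 1 from rfl, one_smul]; abel
      rw [e2]
      refine Submodule.sub_mem _ (Submodule.sub_mem _ (Submodule.smul_mem _ _ (hu i))
        (Submodule.smul_of_tower_mem _ _ (h1 _))) (Submodule.sum_mem _ ?_)
      intro s hs
      by_cases h' : ∃ j, s = ipt j
      · obtain ⟨j, rfl⟩ := h'
        have : i ≠ j := by rintro rfl; simp at hs
        rw [lfun_ipt, if_neg this, show sg 0 = 0 from rfl, zero_smul]
        exact Submodule.zero_mem _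
      · push Not at h'
        exact Submodule.smul_mem _ _ (Submodule.add_mem _ (h0 s h')
          (Submodule.smul_of_tower_mem _ _ (h1 _)))
    · push Not at h
      exact h0 t h
  · exact h1 t

lemma mem_of_int (S : Submodule ℤ VP) (hS : ∀ t k, Ev t k ∈ S) (x : VP)
    (hx : ∀ p, ∃ k : ℤ, x p = k) : x ∈ S := by
  choose k hk using hx
  have : x = ∑ p : IP, k p • Ev p.1 p.2 := by
    ext q
    rw [hk, Finset.sum_apply]
    simp [Ev, Pi.single_apply]
  rw [this]
  exact Submodule.sum_mem _ fun p _ => Submodule.smul_mem _ _ (hS _ _)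

lemma zmod_dvd {a : ℤ} (h : (a : ZMod 3) = 0) : ∃ k : ℤ, a = 3 * k :=
  (ZMod.intCast_zmod_eq_zero_iff_dvd a 3).mp h

lemma Aff_span {x : VP} (hx : Aff x) : x ∈ Submodule.span ℤ (Set.range pb) := by
  obtain ⟨m, n, h, d, e, f, ha⟩ := hx
  have hu : ∀ i, uline i ∈ Submodule.span ℤ (Set.range pb) := by
    intro i
    rw [← pb_ipt]
    exact Submodule.subset_span ⟨_, rfl⟩
  have h1 : x - ∑ i, m (ipt i) • uline i ∈ Submodule.span ℤ (Set.range pb) := by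
    apply mem_of_int _ Ev_span
    have key : ∀ t, ((m t - ∑ i, m (ipt i) * sg (lfun i t) : ℤ) : ZMod 3) = 0 := by
      intro t
      push_cast
      simp only [sg_cast, Fin.sum_univ_three, ha]
      simp [ipt, lfun]
      ring
    rintro ⟨t, k⟩
    obtain ⟨a, ha'⟩ := zmod_dvd (key t)
    have hb : ((n t - 2 * ∑ i, m (ipt i) * sg (lfun i t) : ℤ) : ZMod 3) = 0 := by
      have := key t
      push_cast at this ⊢
      rw [(h t).2.2]
      linear_combination 2 * this
    obtain ⟨b, hb'⟩ := zmod_dvd hb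
    have ha2 : (m t : ℚ) - ∑ i, (m (ipt i) : ℚ) * sg (lfun i t) = 3 * a := by exact_mod_cast ha'
    have hb2 : (n t : ℚ) - 2 * ∑ i, (m (ipt i) : ℚ) * sg (lfun i t) = 3 * b := by
      exact_mod_cast hb'
    fin_cases k
    · refine ⟨a, ?_⟩
      simp only [Pi.sub_apply, Finset.sum_apply, Pi.smul_apply]
      simp only [uline_apply, zsmul_eq_mul]
      simp only [Fin.sum_univ_three] at ha2 ⊢
      simp [(h t).1]
      linarith
    · refine ⟨b, ?_⟩
      simp only [Pi.sub_apply, Finset.sum_apply, Pi.smul_apply]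
      simp only [uline_apply, zsmul_eq_mul]
      simp only [Fin.sum_univ_three] at hb2 ⊢
      simp [(h t).2.1]
      linarith
  have h2 : ∑ i, m (ipt i) • uline i ∈ Submodule.span ℤ (Set.range pb) :=
    Submodule.sum_mem _ fun i _ => Submodule.smul_mem _ _ (hu i)
  have := Submodule.add_mem _ h1 h2
  simpa using this

lemma mem_lineF (p d t : F3) (hd : d ≠ 0) :
    t ∈ lineF p d ↔ d.1 * (t.2 - p.2) - d.2 * (t.1 - p.1) = 0 := by
  have : ∀ d s : F3, d ≠ 0 → ((∃ c : ZMod 3, c • d = s) ↔ d.1 * s.2 - d.2 * s.1 = 0) := by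
    decide
  have h := this d (t - p) hd
  simp only [Prod.fst_sub, Prod.snd_sub] at h
  rw [← h]
  simp only [lineF, Finset.mem_image, Finset.mem_univ, true_and]
  constructor
  · rintro ⟨c, rfl⟩; exact ⟨c, by abel⟩
  · rintro ⟨c, hc⟩; exact ⟨c, by rw [hc]; abel⟩

lemma ind_cast (z : ZMod 3) : (((if z = 0 then 1 else 0 : ℤ)) : ZMod 3) = 1 - z ^ 2 := by
  revert z; decide

lemma Plat_eq : Plat = Submodule.span ℤ (Set.range pb) := by
  apply le_antisymm
  · rw [Plat, Submodule.span_le]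
    rintro x (⟨t, k, rfl⟩ | ⟨L, L', ⟨p, p', d, hd, rfl, rfl⟩, rfl⟩)
    · exact Ev_span t k
    · apply Aff_span
      set c : F3 → F3 → ZMod 3 := fun p t => d.1 * (t.2 - p.2) - d.2 * (t.1 - p.1) with hc
      refine ⟨fun t => (if c p t = 0 then 1 else 0) - (if c p' t = 0 then 1 else 0),
        fun t => 2 * ((if c p t = 0 then 1 else 0) - (if c p' t = 0 then 1 else 0)), ?_, ?_⟩
      · intro t
        simp only [Pi.sub_apply, eL_apply, mem_lineF _ _ _ hd, hc]
        refine ⟨?_, ?_, by push_cast; ring⟩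
        · simp only [if_true]; split_ifs <;> norm_num
        · simp only [if_neg (show ¬ (1 : Fin 2) = 0 by decide)]; split_ifs <;> norm_num
      · set k := c p (0,0) with hk
        set k' := c p' (0,0) with hk'
        refine ⟨k' ^ 2 - k ^ 2, -2 * d.2 * (k' - k), 2 * d.1 * (k' - k), ?_⟩
        intro t
        have e1 : c p t = d.1 * t.2 - d.2 * t.1 + k := by simp only [hk, hc]; ring
        have e2 : c p' t = d.1 * t.2 - d.2 * t.1 + k' := by simp only [hk', hc]; ring
        rw [Int.cast_sub, ind_cast, ind_cast, e1, e2]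
        ring
  · rw [Submodule.span_le]
    rintro _ ⟨p, rfl⟩
    exact pb_mem p

lemma Aff_mem {x : VP} (hx : Aff x) : x ∈ Plat := Plat_eq ▸ Aff_span hx

def Pbm : Matrix IP IP ℚ := Matrix.of pb

lemma Pbm_det : Pbm.det = 1 / 27 := by
  have hno : ∀ p : IP, (¬ ∃ i, p = (ipt i, 0)) → pb p = Ev p.1 p.2 := fun p hp => by
    push Not at hp; exact pb_other p hp
  rw [Matrix.twoBlockTriangular_det Pbm (fun p => ∃ i, p = (ipt i, 0))]
  · have h1 : Pbm.toSquareBlockProp (fun p => ∃ i, p = (ipt i, 0)) =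
        (1/3 : ℚ) • (1 : Matrix {p : IP // ∃ i, p = (ipt i, 0)} _ ℚ) := by
      ext ⟨_, i, rfl⟩ ⟨_, j, rfl⟩
      simp only [Matrix.toSquareBlockProp, Matrix.toBlock_apply, Pbm, Matrix.of_apply, pb_ipt,
        uline_apply, lfun_ipt, Matrix.smul_apply, Matrix.one_apply, Subtype.mk.injEq,
        Prod.mk.injEq, ipt_inj.eq_iff, and_true]
      by_cases h : i = j
      · simp [h, sg]
      · simp [h, sg]
    have h2 : Pbm.toSquareBlockProp (fun p => ¬ ∃ i, p = (ipt i, 0)) = 1 := by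
      ext ⟨p, hp⟩ ⟨q, hq⟩
      simp only [Matrix.toSquareBlockProp, Matrix.toBlock_apply, Pbm, Matrix.of_apply, hno p hp,
        Ev, Pi.single_apply, Matrix.one_apply, Subtype.mk.injEq]
      simp [eq_comm]
    rw [h1, h2, Matrix.det_one, Matrix.det_smul, Matrix.det_one]
    have : Fintype.card {p : IP // ∃ i, p = (ipt i, 0)} = 3 := by decide
    rw [this]; norm_num
  · rintro p hp _ ⟨j, rfl⟩
    simp only [Pbm, Matrix.of_apply, hno p hp, Ev, Pi.single_apply]
    rw [if_neg]
    rintro h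
    exact hp ⟨j, h.symm⟩

lemma pb_li : LinearIndependent ℤ pb := by
  have h : LinearIndependent ℚ Pbm.row :=
    Matrix.linearIndependent_rows_of_det_ne_zero (A := Pbm) (by rw [Pbm_det]; norm_num)
  have h2 : LinearIndependent ℚ pb := h
  exact h2.restrict_scalars (by intro a b h; simpa using h)

def pbP (p : IP) : Plat := ⟨pb p, pb_mem p⟩

lemma pbP_li : LinearIndependent ℤ pbP :=
  LinearIndependent.of_comp Plat.subtype pb_li

lemma pbP_span : ⊤ ≤ Submodule.span ℤ (Set.range pbP) := by
  rintro ⟨x, hx⟩ -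
  have h : Submodule.map Plat.subtype (Submodule.span ℤ (Set.range pbP)) = Plat := by
    rw [Submodule.map_span, ← Set.range_comp]
    exact Plat_eq.symm
  have hx' := hx
  rw [← h] at hx'
  obtain ⟨y, hy, hyx⟩ := hx'
  have : y = ⟨x, hx⟩ := Subtype.ext hyx
  rwa [← this]

def bP : Module.Basis IP ℤ Plat := Module.Basis.mk pbP_li pbP_span
/-! Section 4: projection away from a root lattice of type A2^τ -/
section proj
variable {Γ : Type} [AddCommGroup Γ] (L : LinearMap.BilinForm ℤ Γ)
  {τ : Type} [Fintype τ] [DecidableEq τ] (ε : τ → Fin 2 → Γ)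

def prj (v : Γ) : Γ := (3 : ℤ) • v - ∑ t, ((2 * L v (ε t 0) + L v (ε t 1)) • ε t 0 +
  (L v (ε t 0) + 2 * L v (ε t 1)) • ε t 1)

def TT (v w : Γ) : ℤ := 3 * L v w - ∑ t, (2 * (L v (ε t 0) * L w (ε t 0)) +
  2 * (L v (ε t 1) * L w (ε t 1)) + L v (ε t 0) * L w (ε t 1) + L v (ε t 1) * L w (ε t 0))

structure A2s : Prop where
  symm : ∀ v w, L v w = L w v
  gram : ∀ s t k l, L (ε s k) (ε t l) = if s = t then (if k = l then 2 else -1) else 0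

variable {L ε}

lemma A2s.prj_left (H : A2s L ε) (v w : Γ) : L (prj L ε v) w = TT L ε v w := by
  simp only [prj, TT, map_sub, LinearMap.sub_apply, map_smul, LinearMap.smul_apply, map_sum,
    LinearMap.sum_apply, map_add, LinearMap.add_apply, smul_eq_mul, H.symm _ w]
  rw [H.symm w v]
  congr 1
  apply Finset.sum_congr rfl
  intro t _
  ring

lemma A2s.TT_symm (H : A2s L ε) (v w : Γ) : TT L ε v w = TT L ε w v := by
  rw [TT, TT, H.symm v w]
  congr 1
  apply Finset.sum_congr rfl
  intro t _
  ring

lemma A2s.TT_eps (H : A2s L ε) (v : Γ) (s : τ) (k : Fin 2) : TT L ε v (ε s k) = 0 := by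
  rw [TT]
  simp only [H.gram, mul_ite, mul_zero]
  rw [Finset.sum_eq_single s]
  · fin_cases k <;> simp <;> ring
  · intro b _ hb
    simp [hb.symm]
  · simp

lemma A2s.prj_orth (H : A2s L ε) (v : Γ) (s : τ) (k : Fin 2) : L (prj L ε v) (ε s k) = 0 := by
  rw [H.prj_left, H.TT_eps]

lemma A2s.prj_prj (H : A2s L ε) (v w : Γ) :
    L (prj L ε v) (prj L ε w) = 3 * TT L ε v w := by
  conv_lhs => rw [prj.eq_1 L ε w]
  simp only [map_sub, map_smul, map_sum, map_add, smul_eq_mul, H.prj_orth]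
  rw [H.prj_left]
  simp

lemma TT_add (v v' w : Γ) : TT L ε (v + v') w = TT L ε v w + TT L ε v' w := by
  simp only [TT, map_add, LinearMap.add_apply]
  rw [mul_add, sub_add_sub_comm, ← Finset.sum_add_distrib]
  congr 1
  apply Finset.sum_congr rfl
  intro t _
  ring

lemma A2s.TT_nonneg (H : A2s L ε) (hp : ∀ v, 0 ≤ L v v) (v : Γ) : 0 ≤ TT L ε v v := by
  have := hp (prj L ε v)
  rw [H.prj_prj] at this
  linarith

lemma TT_even (he : ∀ v, ∃ k, L v v = 2 * k) (v : Γ) : ∃ k, TT L ε v v = 2 * k := by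
  obtain ⟨k, hk⟩ := he v
  refine ⟨3 * k - ∑ t, (L v (ε t 0) * L v (ε t 0) +
    L v (ε t 1) * L v (ε t 1) + L v (ε t 0) * L v (ε t 1)), ?_⟩
  rw [TT, hk, mul_sub, Finset.mul_sum]
  congr 1
  · ring
  · apply Finset.sum_congr rfl
    intro t _
    ring

lemma TT_mod (v w : Γ) : ((TT L ε v w : ℤ) : ZMod 3) =
    ∑ t, ((L v (ε t 1) - L v (ε t 0) : ℤ) : ZMod 3) * ((L w (ε t 1) - L w (ε t 0) : ℤ) : ZMod 3) := by
  have h3 : (3 : ZMod 3) = 0 := rfl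
  rw [TT]
  push_cast
  rw [h3, zero_mul, zero_sub, ← Finset.sum_neg_distrib]
  apply Finset.sum_congr rfl
  intro t _
  linear_combination (-((L v (ε t 0) : ZMod 3) * L w (ε t 0)) - ((L v (ε t 1) : ZMod 3) * L w (ε t 1))) * h3

end proj
/-! Section 5: quadratic functions on F3 and the glue invariant -/

def qA (f : F3 → ZMod 3) : ZMod 3 := -(f (0,0) + f (1,0) + f (2,0))
def qC (f : F3 → ZMod 3) : ZMod 3 := -(f (0,0) + f (0,1) + f (0,2))
def qB (f : F3 → ZMod 3) : ZMod 3 :=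
  f (1,1) - f (0,0) - (f (2,0) - f (1,0)) - (f (0,2) - f (0,1)) - qA f - qC f

lemma sumF3 (g : F3 → ZMod 3) : ∑ t, g t = g (0,0) + g (0,1) + g (0,2) + (g (1,0) + g (1,1) + g (1,2))
    + (g (2,0) + g (2,1) + g (2,2)) := by
  rw [Fintype.sum_prod_type]
  have h : ∀ h : ZMod 3 → ZMod 3, ∑ x, h x = h 0 + h 1 + h 2 := fun h => Fin.sum_univ_three h
  simp only [h]

lemma forallF3 {p : F3 → Prop} (h1 : p (0,0)) (h2 : p (0,1)) (h3 : p (0,2)) (h4 : p (1,0))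
    (h5 : p (1,1)) (h6 : p (1,2)) (h7 : p (2,0)) (h8 : p (2,1)) (h9 : p (2,2)) : ∀ t, p t := by
  have h : ∀ t : F3, t = (0,0) ∨ t = (0,1) ∨ t = (0,2) ∨ t = (1,0) ∨ t = (1,1) ∨ t = (1,2) ∨
    t = (2,0) ∨ t = (2,1) ∨ t = (2,2) := by decide
  intro t
  rcases h t with h | h | h | h | h | h | h | h | h <;> subst h <;> assumption

def QF (f : F3 → ZMod 3) : Prop := ∀ t : F3, f t = f (0,0) + (f (2,0) - f (1,0)) * t.1 +
  (f (0,2) - f (0,1)) * t.2 + qA f * t.1 ^ 2 + qB f * t.1 * t.2 + qC f * t.2 ^ 2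

lemma QF_of (f : F3 → ZMod 3) (h : ∀ i, ∑ t, lfun i t * f t = 0) : QF f := by
  have h0 := h 0
  have h1 := h 1
  have h2 := h 2
  rw [sumF3] at h0 h1 h2
  simp only [lfun] at h0 h1 h2
  simp at h0 h1 h2
  unfold QF
  clear h
  apply forallF3 <;> simp only [qA, qB, qC] <;> grind

lemma QF_sum (f g : F3 → ZMod 3) (hf : QF f) (hg : QF g) :
    ∑ t, f t * g t = qA f * qC g + qC f * qA g + qB f * qB g := by
  rw [Finset.sum_congr rfl (fun t _ => by rw [hf t, hg t]), sumF3]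
  simp only []
  generalize qA f = a
  generalize qB f = b
  generalize qC f = c
  generalize qA g = a'
  generalize qB g = b'
  generalize qC g = c'
  ring_nf
  reduce_mod_char
abbrev K3 : Type := ZMod 3 × ZMod 3 × ZMod 3

def bK (c d : K3) : ZMod 3 := c.1 * d.2.2 + c.2.2 * d.1 + c.2.1 * d.2.1

def uK (i : Fin 3) : K3 := if i = 0 then (1,0,1) else if i = 1 then (1,1,2) else (1,2,2)

def ixK (c : K3) : Fin 3 := if c.2.1 = 0 then 0 else if c.2.1 = c.1 then 1 else 2

lemma bK_ix : ∀ c : K3, bK c c = 2 → c = uK (ixK c) ∨ c = - uK (ixK c) := by decide +kernel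

lemma bK_cong : ∀ c d : K3, bK c c = 2 → bK d d = 2 → bK c d = 2 → c = d := by decide +kernel

lemma bK_orth : ∀ c d : K3, bK c c = 2 → bK d d = 2 → bK c d = 0 → ixK c ≠ ixK d := by
  decide +kernel

lemma no4Fin : ∀ a b c d : Fin 3, b ≠ a → c ≠ a → c ≠ b → d ≠ a → d ≠ b → d ≠ c → False := by
  intro a b c d h1 h2 h3 h4 h5 h6; omega

lemma bK_add (c d e : K3) : bK c (d + e) = bK c d + bK c e := by
  simp [bK]; ring

lemma bK_neg (c d : K3) : bK c (-d) = - bK c d := by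
  simp [bK]; ring

lemma bK_sub (c d e : K3) : bK c (d - e) = bK c d - bK c e := by
  simp [bK]; ring

structure Ctx {Γ : Type} [AddCommGroup Γ] (L : LinearMap.BilinForm ℤ Γ) (φ : Plat →ₗ[ℤ] Γ) :
    Prop where
  symm : ∀ v w, L v w = L w v
  pos : ∀ v, v ≠ 0 → 0 < L v v
  even : ∀ v, ∃ k, L v v = 2 * k
  iso : ∀ x y : Plat, ((L (φ x) (φ y) : ℤ) : ℚ) = - BP (x : VP) (y : VP)

section ctx
variable {Γ : Type} [AddCommGroup Γ] (L : LinearMap.BilinForm ℤ Γ) (φ : Plat →ₗ[ℤ] Γ)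

def ep (t : F3) (k : Fin 2) : Γ := φ ⟨Ev t k, Ev_mem t k⟩

def ff (v : Γ) (t : F3) : ZMod 3 := ((L v (ep φ t 1) - L v (ep φ t 0) : ℤ) : ZMod 3)

def cK (v : Γ) : K3 := (qA (ff L φ v), qB (ff L φ v), qC (ff L φ v))

def Tq (v w : Γ) : ℚ := (TT L (ep φ) v w : ℚ)

variable {L φ}

lemma BP_Ev (s t : F3) (k l : Fin 2) :
    BP (Ev s k) (Ev t l) = if s = t then (if k = l then -2 else 1) else 0 := by
  rw [BP, Finset.sum_eq_single (s, k), Finset.sum_eq_single (t, l)]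
  · simp [Ev, GP]
  · intro b _ hb
    simp [Ev, hb]
  · simp
  · intro b _ hb
    simp [Ev, hb]
  · simp

namespace Ctx
variable (C : Ctx L φ)
include C

lemma a2 : A2s L (ep φ) where
  symm := C.symm
  gram := by
    intro s t k l
    have h := C.iso ⟨Ev s k, Ev_mem s k⟩ ⟨Ev t l, Ev_mem t l⟩
    rw [BP_Ev] at h
    have h2 : ((L (ep φ s k) (ep φ t l) : ℤ) : ℚ) =
        ((if s = t then (if k = l then 2 else -1) else 0 : ℤ) : ℚ) := by
      rw [ep, ep, h]; split_ifs <;> simp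
    exact_mod_cast h2

lemma nonneg (v : Γ) : 0 ≤ L v v := by
  by_cases h : v = 0
  · simp [h]
  · exact (C.pos v h).le

lemma ff_add (v w : Γ) : ff L φ (v + w) = ff L φ v + ff L φ w := by
  ext t
  simp only [ff, Pi.add_apply, map_add, LinearMap.add_apply]
  push_cast
  ring

lemma ff_neg (v : Γ) : ff L φ (-v) = - ff L φ v := by
  ext t
  simp only [ff, Pi.neg_apply, map_neg, LinearMap.neg_apply]
  push_cast
  ring

lemma cK_add (v w : Γ) : cK L φ (v + w) = cK L φ v + cK L φ w := by
  simp only [cK, C.ff_add, qA, qB, qC, Pi.add_apply, Prod.mk_add_mk]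
  refine Prod.ext ?_ (Prod.ext ?_ ?_) <;> simp only [] <;> ring

lemma cK_neg (v : Γ) : cK L φ (-v) = - cK L φ v := by
  simp only [cK, C.ff_neg, qA, qB, qC, Pi.neg_apply, Prod.neg_mk]
  refine Prod.ext ?_ (Prod.ext ?_ ?_) <;> simp only [] <;> ring

lemma qf (v : Γ) : QF (ff L φ v) := by
  apply QF_of
  intro i
  have h : (3 : ℤ) • (⟨uline i, uline_mem i⟩ : Plat) =
      ∑ s : F3, sg (lfun i s) • ((⟨Ev s 0, Ev_mem s 0⟩ : Plat) + (2 : ℤ) • ⟨Ev s 1, Ev_mem s 1⟩) := by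
    apply Subtype.ext
    have := uline_three i
    simp only [EV] at this
    push_cast
    rw [this]
    simp
  have h2 := congrArg (fun x => ((L v (φ x) : ℤ) : ZMod 3)) h
  simp only [map_smul, map_sum, map_add, smul_eq_mul] at h2
  push_cast at h2
  rw [show (3 : ZMod 3) = 0 from rfl, zero_mul] at h2
  rw [← neg_eq_zero, ← Finset.sum_neg_distrib, h2]
  apply Finset.sum_congr rfl
  intro t _
  simp only [ff, sg_cast, ep]
  push_cast
  have h3 : (3 : ZMod 3) = 0 := rfl
  linear_combination -lfun i t * ((L v) (φ ⟨Ev t 1, Ev_mem t 1⟩) : ZMod 3) * h3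

lemma TT_K (v w : Γ) : ((TT L (ep φ) v w : ℤ) : ZMod 3) = bK (cK L φ v) (cK L φ w) := by
  rw [TT_mod]
  exact QF_sum _ _ (C.qf v) (C.qf w)

lemma latH : LatH (⊤ : AddSubgroup Γ) (Tq L φ) where
  pf := {
    symm := fun x y => by rw [Tq, Tq, C.a2.TT_symm]
    add := fun x y z => by rw [Tq, TT_add]; push_cast; rfl
    nonneg := fun x => by
      have := C.a2.TT_nonneg C.nonneg x
      rw [Tq]; exact_mod_cast this }
  int := fun x _ y _ => ⟨_, rfl⟩
  even := fun x _ => by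
    obtain ⟨k, hk⟩ := TT_even (L := L) (ε := ep φ) C.even x
    exact ⟨k, by rw [Tq, hk]; push_cast; rfl⟩
  no4 := by
    have key : ∀ x, Tq L φ x x = 2 → bK (cK L φ x) (cK L φ x) = 2 := by
      intro x hx
      have : TT L (ep φ) x x = 2 := by rw [Tq] at hx; exact_mod_cast hx
      rw [← C.TT_K, this]; rfl
    have key2 : ∀ x y, Tq L φ x x = 2 → Tq L φ y y = 2 → Tq L φ x y = 0 →
        ixK (cK L φ x) ≠ ixK (cK L φ y) := by
      intro x y hx hy h
      have : TT L (ep φ) x y = 0 := by rw [Tq] at h; exact_mod_cast h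
      apply bK_orth _ _ (key _ hx) (key _ hy)
      rw [← C.TT_K, this]; rfl
    intro a _ b _ c _ d _ ha hb hc hd h1 h2 h3 h4 h5 h6
    exact no4Fin _ _ _ _ (key2 _ _ hb ha h1) (key2 _ _ hc ha h2) (key2 _ _ hc hb h3)
      (key2 _ _ hd ha h4) (key2 _ _ hd hb h5) (key2 _ _ hd hc h6)
  cong := by
    intro x _ y _ hx hy hxy w _
    have e1 : TT L (ep φ) x x = 2 := by rw [Tq] at hx; exact_mod_cast hx
    have e2 : TT L (ep φ) y y = 2 := by rw [Tq] at hy; exact_mod_cast hy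
    have e3 : TT L (ep φ) x y = -1 := by rw [Tq] at hxy; exact_mod_cast hxy
    have hc : cK L φ x = cK L φ y := by
      apply bK_cong
      · rw [← C.TT_K, e1]; rfl
      · rw [← C.TT_K, e2]; rfl
      · rw [← C.TT_K, e3]; rfl
    have : ((TT L (ep φ) w x - TT L (ep φ) w y : ℤ) : ZMod 3) = 0 := by
      push_cast
      rw [C.TT_K, C.TT_K, hc, sub_self]
    obtain ⟨k, hk⟩ := zmod_dvd this
    exact ⟨k, by rw [Tq, Tq]; exact_mod_cast hk⟩

end Ctx
end ctx
/-! Section 6: the complementary family of determinant 27 -/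

lemma gd_nonneg {V : Type} [AddCommGroup V] {n : ℕ} : ∀ {B : V → V → ℚ} (_ : PF B) (z : Fin n → V),
    0 ≤ gd B z := by
  induction n with
  | zero => intro B h z; simp [gd]
  | succ n ih =>
    intro B h z
    by_cases h0 : B (z 0) (z 0) = 0
    · have : gd B z = 0 := by
        unfold gd
        apply Matrix.det_eq_zero_of_column_eq_zero 0
        intro i
        simp [h.zero_of h0]
      rw [this]
    · rw [gd_succ h z h0]
      exact mul_nonneg (h.nonneg _) (ih (h.sch _) _)

lemma gram_unimod (A : Matrix (Fin 24) (Fin 24) ℤ) (hdet : A.det = 1 ∨ A.det = -1) {ι : Type}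
    [Fintype ι] [DecidableEq ι] (b : Module.Basis ι ℤ (Fin 24 → ℤ)) :
    (Matrix.of fun i j => Matrix.toBilin' A (b i) (b j)).det = 1 ∨
    (Matrix.of fun i j => Matrix.toBilin' A (b i) (b j)).det = -1 := by
  have e : Fin 24 ≃ ι := by
    apply Fintype.equivOfCardEq
    rw [← Module.finrank_eq_card_basis b, Module.finrank_fin_fun, Fintype.card_fin]
  set b0 := (Pi.basisFun ℤ (Fin 24)).reindex e with hb0
  have h1 := LinearMap.BilinForm.toMatrix_mul_basis_toMatrix b0 b (Matrix.toBilin' A)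
  have h2 : LinearMap.BilinForm.toMatrix b (Matrix.toBilin' A) =
      Matrix.of fun i j => Matrix.toBilin' A (b i) (b j) := by
    ext i j
    rw [LinearMap.BilinForm.toMatrix_apply]; rfl
  have h3 : LinearMap.BilinForm.toMatrix b0 (Matrix.toBilin' A) = A.submatrix e.symm e.symm := by
    ext i j
    rw [LinearMap.BilinForm.toMatrix_apply]
    simp [hb0, Matrix.toBilin'_single]
  rw [← h2, ← h1, h3, Matrix.det_mul, Matrix.det_mul, Matrix.det_transpose,
    Matrix.det_submatrix_equiv_self]
  have hu : IsUnit (b0.toMatrix b).det := by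
    rw [← Module.Basis.det_apply]; exact b0.isUnit_det b
  rcases Int.isUnit_iff.mp hu with h | h <;> rw [h] <;> rcases hdet with h | h <;> rw [h] <;> simp

section fam
variable {Γ : Type} [AddCommGroup Γ] [Module.Finite ℤ Γ] [Module.Free ℤ Γ]

lemma exBasis (hr : Module.finrank ℤ Γ = 24) (φ : Plat →ₗ[ℤ] Γ)
    (hinj : Function.Injective φ)
    (hprim : ∀ (v : Γ) (n : ℤ), n ≠ 0 → n • v ∈ LinearMap.range φ → v ∈ LinearMap.range φ) :
    ∃ b : Module.Basis (IP ⊕ Fin 6) ℤ Γ, ∀ p, b (Sum.inl p) = φ (pbP p) := by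
  let S := LinearMap.range φ
  let bW : Module.Basis IP ℤ S := bP.map (LinearEquiv.ofInjective φ hinj)
  have htf : Module.IsTorsionFree ℤ (Γ ⧸ S) := by
    rw [Module.isTorsionFree_iff_smul_eq_zero]
    intro n x hx
    by_contra hne
    push Not at hne
    obtain ⟨v, rfl⟩ := S.mkQ_surjective x
    rw [← map_smul, Submodule.mkQ_apply, Submodule.Quotient.mk_eq_zero] at hx
    apply hne.2
    rw [Submodule.mkQ_apply, Submodule.Quotient.mk_eq_zero]
    exact hprim v n hne.1 hx
  have hfr : Module.Free ℤ (Γ ⧸ S) := inferInstance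
  have hf6 : Module.finrank ℤ (Γ ⧸ S) = 6 := by
    have h1 := S.finrank_quotient_add_finrank
    have h2 : Module.finrank ℤ S = 18 := by
      rw [Module.finrank_eq_card_basis bW]; rfl
    omega
  let bQ : Module.Basis (Fin 6) ℤ (Γ ⧸ S) := Module.finBasisOfFinrankEq ℤ _ hf6
  refine ⟨bW.sumQuot bQ, fun p => ?_⟩
  rw [Module.Basis.sumQuot_inl]
  simp [bW, bP]
  rfl
end fam

lemma sumIP (g : IP → ℚ) : ∑ p, g p = ∑ t : F3, (g (t, 0) + g (t, 1)) := by
  rw [Fintype.sum_prod_type (f := g)]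
  simp only [Fin.sum_univ_two]

def A9 : Matrix IP IP ℚ := Matrix.of fun p q => if p.1 = q.1 then (if p.2 = q.2 then 2 else -1) else 0

def A9i : Matrix IP IP ℚ :=
  Matrix.of fun p q => if p.1 = q.1 then (if p.2 = q.2 then 2 / 3 else 1 / 3) else 0

lemma A9_mul : A9 * A9i = 1 := by
  ext ⟨s, k⟩ ⟨t, l⟩
  simp only [A9, A9i, Matrix.mul_apply, Matrix.of_apply, sumIP,
    Matrix.one_apply, Prod.mk.injEq, ite_mul, mul_ite, zero_mul, mul_zero]
  rw [Finset.sum_eq_single s]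
  · by_cases h : s = t
    · subst h
      fin_cases k <;> fin_cases l <;> norm_num
    · simp [h]
  · intro b _ hb
    simp [hb.symm]
  · simp

lemma A9_det : A9.det = 3 ^ 9 := by
  have : A9 = Matrix.kroneckerMap (· * ·) (1 : Matrix F3 F3 ℚ) !![2, -1; -1, 2] := by
    ext ⟨s, k⟩ ⟨t, l⟩
    simp only [A9, Matrix.of_apply, Matrix.kroneckerMap_apply, Matrix.one_apply]
    by_cases h : s = t
    · fin_cases k <;> fin_cases l <;> simp [h]
    · simp [h]
  rw [this, Matrix.det_kronecker, Matrix.det_fin_two]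
  simp
  norm_num

lemma Plat_three {x : VP} (hx : x ∈ Plat) : ∀ p, ∃ k : ℤ, 3 * x p = k := by
  induction hx using Submodule.span_induction with
  | mem x h =>
    rcases h with ⟨t, k, rfl⟩ | ⟨L, L', -, rfl⟩
    · intro p
      by_cases h : p = (t, k)
      · exact ⟨3, by simp [Ev, h]⟩
      · exact ⟨0, by simp [Ev, h]⟩
    · rintro ⟨t, k⟩
      simp only [Pi.sub_apply, eL_apply]
      refine ⟨(if t ∈ L then (if k = 0 then 1 else 2) else 0) -
        (if t ∈ L' then (if k = 0 then 1 else 2) else 0), ?_⟩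
      split_ifs <;> push_cast <;> ring
  | zero => intro p; exact ⟨0, by simp⟩
  | add x y _ _ hx hy =>
    intro p
    obtain ⟨a, ha⟩ := hx p
    obtain ⟨b, hb⟩ := hy p
    exact ⟨a + b, by push_cast; rw [← ha, ← hb, Pi.add_apply]; ring⟩
  | smul n x _ hx =>
    intro p
    obtain ⟨a, ha⟩ := hx p
    exact ⟨n * a, by push_cast; rw [← ha, Pi.smul_apply, zsmul_eq_mul]; ring⟩

lemma Lphi {Γ : Type} [AddCommGroup Γ] (L : LinearMap.BilinForm ℤ Γ) (φ : Plat →ₗ[ℤ] Γ)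
    (x : Plat) (w : Γ) :
    ((L (φ x) w : ℤ) : ℚ) = ∑ q : IP, (x : VP) q * ((L (ep φ q.1 q.2) w : ℤ) : ℚ) := by
  choose k hk using Plat_three x.2
  have h : (3 : ℤ) • x = ∑ q : IP, k q • (⟨Ev q.1 q.2, Ev_mem _ _⟩ : Plat) := by
    apply Subtype.ext
    push_cast
    ext q
    simp only [Finset.sum_apply, Pi.smul_apply]
    rw [Finset.sum_eq_single q]
    · simp [Ev, hk]
    · intro b _ hb
      simp [Ev, hb.symm]
    · simp
  have h2 := congrArg (fun x => ((L (φ x) w : ℤ) : ℚ)) h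
  simp only [map_smul, map_sum, LinearMap.smul_apply, LinearMap.sum_apply, smul_eq_mul] at h2
  push_cast at h2
  have h3 : (3 : ℚ) * ∑ q : IP, (x : VP) q * ((L (ep φ q.1 q.2) w : ℤ) : ℚ) =
     ∑ q : IP, (k q : ℚ) * ((L (ep φ q.1 q.2) w : ℤ) : ℚ) := by
    rw [Finset.mul_sum]
    apply Finset.sum_congr rfl
    intro q _
    rw [← hk, mul_assoc]
  simp only [ep] at h3 ⊢
  linarith

lemma fam_det {Γ : Type} [AddCommGroup Γ] {L : LinearMap.BilinForm ℤ Γ} {φ : Plat →ₗ[ℤ] Γ}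
    (C : Ctx L φ) (b : IP ⊕ Fin 6 → Γ) (hb : ∀ p, b (Sum.inl p) = φ (pbP p)) :
    (((Matrix.of fun i j => L (b i) (b j)).det : ℤ) : ℚ) =
      gd (Tq L φ) (fun i => b (Sum.inr i)) / 27 := by
  set X : Matrix IP (Fin 6) ℚ := Matrix.of fun p j => ((L (ep φ p.1 p.2) (b (Sum.inr j)) : ℤ) : ℚ)
    with hX
  set D : Matrix (Fin 6) (Fin 6) ℚ :=
    Matrix.of fun i j => ((L (b (Sum.inr i)) (b (Sum.inr j)) : ℤ) : ℚ) with hD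
  set N : Matrix (IP ⊕ Fin 6) (IP ⊕ Fin 6) ℚ := Matrix.fromBlocks Pbm 0 0 1 with hN
  have hG : (Matrix.of fun i j => L (b i) (b j)).map (Int.cast : ℤ → ℚ) =
      N * Matrix.fromBlocks A9 X X.transpose D * N.transpose := by
    rw [hN, Matrix.fromBlocks_transpose, Matrix.fromBlocks_multiply, Matrix.fromBlocks_multiply]
    simp only [Matrix.transpose_zero, Matrix.transpose_one, Matrix.zero_mul, Matrix.mul_zero,
      add_zero, zero_add, Matrix.mul_one, Matrix.one_mul]
    ext (p | i) (q | j)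
    · simp only [Matrix.map_apply, Matrix.of_apply, Matrix.fromBlocks_apply₁₁, hb]
      rw [Lphi, Matrix.mul_assoc, Matrix.mul_apply]
      apply Finset.sum_congr rfl
      intro r _
      congr 1
      rw [C.symm, Lphi, Matrix.mul_apply]
      apply Finset.sum_congr rfl
      intro s _
      rw [C.a2.gram, mul_comm]
      congr 1
      simp only [A9, Matrix.of_apply]
      split_ifs <;> simp_all
    · simp only [Matrix.map_apply, Matrix.of_apply, Matrix.fromBlocks_apply₁₂, hb]
      rw [Lphi, Matrix.mul_apply]
      rfl
    · simp only [Matrix.map_apply, Matrix.of_apply, Matrix.fromBlocks_apply₂₁, hb]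
      rw [C.symm, Lphi, Matrix.mul_apply]
      apply Finset.sum_congr rfl
      intro s _
      rw [mul_comm]; rfl
    · simp [hD]
  have h1 : (((Matrix.of fun i j => L (b i) (b j)).det : ℤ) : ℚ) =
      ((Matrix.of fun i j => L (b i) (b j)).map (Int.cast : ℤ → ℚ)).det := by
    have := (Int.castRingHom ℚ).map_det (Matrix.of fun i j => L (b i) (b j))
    simpa using this
  let hI : Invertible A9 := ⟨A9i, _root_.mul_eq_one_comm.mp A9_mul, A9_mul⟩
  have hinv : ⅟A9 = A9i := by rfl
  have hNd : N.det = 1 / 27 := by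
    rw [hN, Matrix.det_fromBlocks_zero₂₁, Pbm_det, Matrix.det_one, mul_one]
  have hS : D - X.transpose * ⅟A9 * X =
      (1 / 3 : ℚ) • Matrix.of fun i j => Tq L φ (b (Sum.inr i)) (b (Sum.inr j)) := by
    rw [hinv]
    ext i j
    simp only [Matrix.sub_apply, Matrix.smul_apply, Matrix.of_apply, Tq, TT, hD, smul_eq_mul]
    push_cast
    rw [Matrix.mul_assoc, Matrix.mul_apply, sumIP, mul_sub, Finset.mul_sum]
    congr 1
    · ring
    · apply Finset.sum_congr rfl
      intro t _
      simp only [Matrix.mul_apply, sumIP, A9i, Matrix.of_apply,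
        hX, Matrix.transpose_apply]
      rw [Finset.sum_eq_single t, Finset.sum_eq_single t]
      · simp [C.symm (b _)]
        ring
      · intro s _ hs
        simp [hs.symm]
      · simp
      · intro s _ hs
        simp [hs.symm]
      · simp
  rw [h1, hG, Matrix.det_mul, Matrix.det_mul, Matrix.det_transpose, hNd, Matrix.det_fromBlocks₁₁, hS,
    Matrix.det_smul, A9_det, gd]
  simp
  ring
/-! Section 7: the three extra A2 components -/
section extra
variable {Γ : Type} [AddCommGroup Γ] {L : LinearMap.BilinForm ℤ Γ} {φ : Plat →ₗ[ℤ] Γ}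

lemma Ctx.lift (C : Ctx L φ) (w : Γ) (hw : cK L φ w = 0) : ∃ k : Γ, (3 : ℤ) • k = prj L (ep φ) w := by
  set p : VP := fun q => if q.2 = 0 then ((2 * L w (ep φ q.1 0) + L w (ep φ q.1 1) : ℤ) : ℚ) / 3
    else ((L w (ep φ q.1 0) + 2 * L w (ep φ q.1 1) : ℤ) : ℚ) / 3 with hp
  have h3 : (3 : ZMod 3) = 0 := rfl
  have hA : Aff p := by
    refine ⟨fun t => 2 * L w (ep φ t 0) + L w (ep φ t 1), fun t => L w (ep φ t 0) + 2 * L w (ep φ t 1),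
      fun t => ⟨by simp [hp], by simp [hp], ?_⟩, ff L φ w (0,0),
      ff L φ w (2,0) - ff L φ w (1,0), ff L φ w (0,2) - ff L φ w (0,1), fun t => ?_⟩
    · push_cast
      linear_combination -(L w (ep φ t 0) : ZMod 3) * h3
    · have h := C.qf w t
      rw [cK, Prod.mk_eq_zero, Prod.mk_eq_zero] at hw
      rw [hw.1, hw.2.1, hw.2.2] at h
      simp only [zero_mul, add_zero] at h
      rw [← h, ff]
      push_cast
      linear_combination (L w (ep φ t 0) : ZMod 3) * h3
  have hP := Aff_mem hA
  refine ⟨w - φ ⟨p, hP⟩, ?_⟩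
  have h : (3 : ℤ) • (⟨p, hP⟩ : Plat) = ∑ t : F3,
      ((2 * L w (ep φ t 0) + L w (ep φ t 1)) • (⟨Ev t 0, Ev_mem t 0⟩ : Plat) +
        (L w (ep φ t 0) + 2 * L w (ep φ t 1)) • (⟨Ev t 1, Ev_mem t 1⟩ : Plat)) := by
    apply Subtype.ext
    push_cast
    ext ⟨s, k⟩
    simp only [Finset.sum_apply, Pi.smul_apply, Pi.add_apply]
    rw [Finset.sum_eq_single s]
    · fin_cases k <;> simp [Ev, hp] <;> ring
    · intro b _ hb
      simp [Ev, hb.symm]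
    · simp
  have h2 := congrArg φ h
  simp only [map_smul, map_sum, map_add] at h2
  rw [smul_sub, h2, prj]
  rfl

lemma Ctx.norm2 (C : Ctx L φ) {x y : Γ} {n : ℤ} (hx : Tq L φ x y = n) :
    bK (cK L φ x) (cK L φ y) = (n : ZMod 3) := by
  have : TT L (ep φ) x y = n := by rw [Tq] at hx; exact_mod_cast hx
  rw [← C.TT_K, this]

lemma Ctx.three (C : Ctx L φ) (z : Fin 6 → Γ) (hz : gd (Tq L φ) z = 27) :
    ∃ x y : Fin 3 → Γ, (∀ i, Tq L φ (x i) (x i) = 2 ∧ Tq L φ (y i) (y i) = 2 ∧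
      Tq L φ (x i) (y i) = -1 ∧ cK L φ (x i) = uK i ∧ cK L φ (y i) = uK i) ∧
      ∀ i j, i ≠ j → Tq L φ (x i) (x j) = 0 ∧ Tq L φ (x i) (y j) = 0 ∧ Tq L φ (y i) (x j) = 0 ∧
        Tq L φ (y i) (y j) = 0 := by
  have hpf := C.latH.pf
  obtain ⟨x, y, h1, h2⟩ := threeHex C.latH z (fun _ => trivial) hz
  have hcx : ∀ i, bK (cK L φ (x i)) (cK L φ (x i)) = 2 := fun i => by
    simpa using C.norm2 (n := 2) (by simpa using (h1 i).2.2.1)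
  have hcy : ∀ i, bK (cK L φ (y i)) (cK L φ (y i)) = 2 := fun i => by
    simpa using C.norm2 (n := 2) (by simpa using (h1 i).2.2.2.1)
  have hxy : ∀ i, cK L φ (x i) = cK L φ (y i) := fun i => by
    apply bK_cong _ _ (hcx i) (hcy i)
    rw [C.norm2 (n := -1) (by simpa using (h1 i).2.2.2.2)]; rfl
  have hinj : Function.Injective (fun i => ixK (cK L φ (y i))) := by
    intro i j hij
    by_contra hne
    refine bK_orth _ _ (hcy i) (hcy j) ?_ hij
    rw [C.norm2 (n := 0) (by simpa using (h2 i j hne).2.2.2)]; rfl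
  let π : Fin 3 ≃ Fin 3 := Equiv.ofBijective _ ((Finite.injective_iff_bijective).mp hinj)
  have hπ : ∀ j, ixK (cK L φ (y (π.symm j))) = j := fun j => π.apply_symm_apply j
  have hs : ∀ j, ∃ s : ℤ, s * s = 1 ∧ cK L φ (s • y (π.symm j)) = uK j ∧
      cK L φ (s • x (π.symm j)) = uK j := by
    intro j
    rcases bK_ix _ (hcy (π.symm j)) with h | h
    · rw [hπ] at h
      exact ⟨1, by norm_num, by rw [one_smul, h], by rw [one_smul, hxy, h]⟩
    · rw [hπ] at h
      refine ⟨-1, by norm_num, ?_, ?_⟩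
      · rw [neg_smul, one_smul, C.cK_neg, h, neg_neg]
      · rw [neg_smul, one_smul, C.cK_neg, hxy, h, neg_neg]
  choose s hs1 hs2 hs3 using hs
  have hsq : ∀ j, (s j : ℚ) * s j = 1 := fun j => by exact_mod_cast hs1 j
  refine ⟨fun j => s j • x (π.symm j), fun j => s j • y (π.symm j), fun j => ⟨?_, ?_, ?_, hs3 j, hs2 j⟩, ?_⟩
  · rw [hpf.zsmul, hpf.zsmul', ← mul_assoc, hsq, (h1 _).2.2.1]; norm_num
  · rw [hpf.zsmul, hpf.zsmul', ← mul_assoc, hsq, (h1 _).2.2.2.1]; norm_num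
  · rw [hpf.zsmul, hpf.zsmul', ← mul_assoc, hsq, (h1 _).2.2.2.2]; norm_num
  · intro i j hij
    obtain ⟨g1, g2, g3, g4⟩ := h2 (π.symm i) (π.symm j) (fun h => hij (π.symm.injective h))
    simp only [hpf.zsmul, hpf.zsmul', g1, g2, g3, g4, mul_zero, and_self]

lemma Ctx.LL (C : Ctx L φ) {w w' k k' : Γ} (h : (3 : ℤ) • k = prj L (ep φ) w)
    (h' : (3 : ℤ) • k' = prj L (ep φ) w') {n : ℤ} (hT : Tq L φ w w' = 3 * n) : L k k' = n := by
  have h1 : L ((3 : ℤ) • k) ((3 : ℤ) • k') = 3 * TT L (ep φ) w w' := by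
    rw [h, h', C.a2.prj_prj]
  have h2 : TT L (ep φ) w w' = 3 * n := by rw [Tq] at hT; exact_mod_cast hT
  simp only [map_smul, LinearMap.smul_apply, smul_eq_mul] at h1
  omega

lemma Ctx.extra (C : Ctx L φ) (z : Fin 6 → Γ) (hz : gd (Tq L φ) z = 27) :
    ∃ e : Fin 3 → Fin 2 → Γ,
      (∀ i j k l, L (e i k) (e j l) = if i = j then (if k = l then 2 else -1) else 0) ∧
      (∀ i k t l, L (e i k) (ep φ t l) = 0) ∧
      (∀ v i, ((L v (e i 1) - L v (e i 0) : ℤ) : ZMod 3) = bK (cK L φ v) (uK i)) := by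
  obtain ⟨x, y, h1, h2⟩ := C.three z hz
  have hpf := C.latH.pf
  have ex0 : ∀ i, ∃ k : Γ, (3 : ℤ) • k = prj L (ep φ) (x i - y i) := fun i => C.lift _ (by
    rw [sub_eq_add_neg, C.cK_add, C.cK_neg, (h1 i).2.2.2.1, (h1 i).2.2.2.2, add_neg_cancel])
  have ex1 : ∀ i, ∃ k : Γ, (3 : ℤ) • k = prj L (ep φ) (x i + (y i + y i)) := fun i => C.lift _ (by
    rw [C.cK_add, C.cK_add, (h1 i).2.2.2.1, (h1 i).2.2.2.2]
    have : ∀ u : K3, u + (u + u) = 0 := by decide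
    exact this _)
  choose e0 he0 using ex0
  choose e1 he1 using ex1
  refine ⟨fun i k => if k = 0 then e0 i else e1 i, ?_, ?_, ?_⟩
  · intro i j k l
    by_cases hij : i = j
    · subst hij
      obtain ⟨a1, a2, a3, -, -⟩ := h1 i
      have a4 : Tq L φ (y i) (x i) = -1 := by rw [hpf.symm, a3]
      rw [if_pos rfl]
      fin_cases k <;> fin_cases l
      · exact C.LL (he0 i) (he0 i) (by simp only [hpf.sub, hpf.sub', a1, a2, a3, a4]; norm_num)
      · exact C.LL (he0 i) (he1 i) (by simp only [hpf.sub, hpf.add', a1, a2, a3, a4]; norm_num)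
      · exact C.LL (he1 i) (he0 i) (by simp only [hpf.add, hpf.sub', a1, a2, a3, a4]; norm_num)
      · exact C.LL (he1 i) (he1 i) (by simp only [hpf.add, hpf.add', a1, a2, a3, a4]; norm_num)
    · obtain ⟨a1, a2, a3, a4⟩ := h2 i j hij
      rw [if_neg hij]
      fin_cases k <;> fin_cases l
      · exact C.LL (he0 i) (he0 j) (by simp only [hpf.sub, hpf.sub', a1, a2, a3, a4]; norm_num)
      · exact C.LL (he0 i) (he1 j) (by simp only [hpf.sub, hpf.add', a1, a2, a3, a4]; norm_num)
      · exact C.LL (he1 i) (he0 j) (by simp only [hpf.add, hpf.sub', a1, a2, a3, a4]; norm_num)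
      · exact C.LL (he1 i) (he1 j) (by simp only [hpf.add, hpf.add', a1, a2, a3, a4]; norm_num)
  · intro i k t l
    have key : ∀ e w : Γ, (3 : ℤ) • e = prj L (ep φ) w → L e (ep φ t l) = 0 := by
      intro e w h
      have := C.a2.prj_orth w t l
      rw [← h] at this
      simpa using this
    fin_cases k
    · exact key _ _ (he0 i)
    · exact key _ _ (he1 i)
  · intro v i
    have key : ∀ e w : Γ, (3 : ℤ) • e = prj L (ep φ) w → ((L v e : ℤ) : ℚ) * 3 = Tq L φ w v := by
      intro e w h
      have := C.a2.prj_left w v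
      rw [← h] at this
      simp only [map_smul, LinearMap.smul_apply, smul_eq_mul] at this
      rw [Tq, ← this, C.symm v e]; push_cast; ring
    have k0 := key _ _ (he0 i)
    have k1 := key _ _ (he1 i)
    rw [hpf.sub] at k0
    rw [hpf.add, hpf.add] at k1
    have k2 : ((L v (e1 i) - L v (e0 i) : ℤ) : ℚ) = Tq L φ (y i) v := by push_cast; linarith
    have k3 : L v (e1 i) - L v (e0 i) = TT L (ep φ) v (y i) := by
      rw [Tq, C.a2.TT_symm] at k2; exact_mod_cast k2
    show ((L v (e1 i) - L v (e0 i) : ℤ) : ZMod 3) = _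
    rw [k3, C.TT_K, (h1 i).2.2.2.2]
end extra
/-! Section 8: assembling the Niemeier lattice -/

def gZ : Fin 6 → Fin 12 → ℤ :=
  ![![0, 1, 1, 1, 1, 1, 1, 0, 0, 0, 0, 0],
    ![-1, 0, 1, -1, -1, 1, 0, 1, 0, 0, 0, 0],
    ![-1, 1, 0, 1, -1, -1, 0, 0, 1, 0, 0, 0],
    ![-1, -1, 1, 0, 1, -1, 0, 0, 0, 1, 0, 0],
    ![-1, -1, -1, 1, 0, 1, 0, 0, 0, 0, 1, 0],
    ![-1, 1, -1, -1, 1, 0, 0, 0, 0, 0, 0, 1]]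

lemma glue_eq (i : Fin 6) (j : Fin 12) : glueMat i j = (gZ i j : ℚ) := by
  fin_cases i <;> fin_cases j <;> simp [glueMat, gZ]

lemma gZ_orth : ∀ i k : Fin 6, ((∑ j, gZ i j * gZ k j : ℤ) : ZMod 3) = 0 := by decide +kernel

lemma gZ_weight : ∀ s0 s1 s2 s3 s4 s5 : ZMod 3,
    (Finset.univ.filter (fun j : Fin 12 => s0 * gZ 0 j + s1 * gZ 1 j + s2 * gZ 2 j + s3 * gZ 3 j +
      s4 * gZ 4 j + s5 * gZ 5 j ≠ 0)).card ≤ 3 →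
    s0 = 0 ∧ s1 = 0 ∧ s2 = 0 ∧ s3 = 0 ∧ s4 = 0 ∧ s5 = 0 := by decide +kernel

lemma EtV_apply (s t : Fin 12) (k : Fin 2) :
    EtV s (t, k) = if s = t then (if k = 0 then 1 else 2) else 0 := by
  unfold EtV Et
  simp only [Pi.add_apply, Pi.smul_apply, Pi.single_apply, Prod.mk.injEq]
  by_cases h : s = t
  · subst h
    fin_cases k <;> simp
  · have h' : ¬ t = s := fun e => h e.symm
    simp [h, h']

lemma wvec_apply (i : Fin 6) (t : Fin 12) (k : Fin 2) :
    wvec i (t, k) = gZ i t * (if k = 0 then 1 else 2) / 3 := by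
  unfold wvec
  simp only [Pi.smul_apply, Finset.sum_apply, EtV_apply, smul_eq_mul, glue_eq, mul_ite, mul_zero,
    Finset.sum_ite_eq', Finset.mem_univ, if_true]
  split_ifs <;> ring

lemma Et_NL (j : Fin 12) (k : Fin 2) : Et j k ∈ NL := Submodule.subset_span (Or.inl ⟨j, k, rfl⟩)

lemma wvec_NL (i : Fin 6) : wvec i ∈ NL := Submodule.subset_span (Or.inr ⟨i, rfl⟩)

lemma int_sum (x : WN) (k : JN → ℤ) (hk : ∀ p, x p = k p) : x = ∑ p : JN, k p • Et p.1 p.2 := by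
  ext q
  rw [hk, Finset.sum_apply]
  simp [Et, Pi.single_apply]

lemma sumJN (g : JN → ℚ) : ∑ p, g p = ∑ t : Fin 12, (g (t, 0) + g (t, 1)) := by
  rw [Fintype.sum_prod_type (f := g)]
  simp only [Fin.sum_univ_two]

lemma BW_eq (x y : WN) : BW x y = ∑ t, (2 * (x (t, 0) * y (t, 0)) - x (t, 0) * y (t, 1) -
    x (t, 1) * y (t, 0) + 2 * (x (t, 1) * y (t, 1))) := by
  rw [BW, sumJN]
  apply Finset.sum_congr rfl
  intro t _
  simp only [sumJN, GN]
  rw [Finset.sum_eq_single t, Finset.sum_eq_single t]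
  · simp; ring
  · intro s _ hs
    simp [hs.symm]
  · simp
  · intro s _ hs
    simp [hs.symm]
  · simp

def G12 : Matrix JN JN ℤ := Matrix.of fun p q => if p.1 = q.1 then (if p.2 = q.2 then 2 else -1) else 0

def G12i : Matrix JN JN ℤ := Matrix.of fun p q => if p.1 = q.1 then (if p.2 = q.2 then 2 else 1) else 0

lemma G12_mul : G12 * G12i = (3 : ℤ) • (1 : Matrix JN JN ℤ) := by
  ext ⟨s, k⟩ ⟨t, l⟩
  simp only [G12, G12i, Matrix.mul_apply, Matrix.of_apply, Fintype.sum_prod_type, Fin.sum_univ_two,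
    Matrix.one_apply, Matrix.smul_apply, Prod.mk.injEq, ite_mul, mul_ite, zero_mul, mul_zero]
  rw [Finset.sum_eq_single s]
  · by_cases h : s = t
    · subst h
      fin_cases k <;> fin_cases l <;> norm_num
    · simp [h]
  · intro b _ hb
    simp [hb.symm]
  · simp

lemma G12_det : G12.det ≠ 0 := by
  have h := congrArg Matrix.det G12_mul
  rw [Matrix.det_mul, Matrix.det_smul, Matrix.det_one] at h
  intro h0
  rw [h0, zero_mul, mul_one] at h
  exact pow_ne_zero _ (by norm_num) h.symm

section final
variable {A : Matrix (Fin 24) (Fin 24) ℤ} {e : Fin 12 → Fin 2 → (Fin 24 → ℤ)}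

local notation "LA" => Matrix.toBilin' A

lemma nondeg (H : A2s LA e) (hdet : A.det = 1 ∨ A.det = -1) (u : Fin 24 → ℤ)
    (hu : ∀ j k, LA u (e j k) = 0) : u = 0 := by
  let σ : Fin 24 ≃ JN := Fintype.equivOfCardEq rfl
  let M : Matrix (Fin 24) (Fin 24) ℤ := Matrix.of fun i => e (σ i).1 (σ i).2
  have hG : M * A * M.transpose = G12.submatrix σ σ := by
    ext i j
    have h := H.gram (σ i).1 (σ j).1 (σ i).2 (σ j).2
    rw [Matrix.toBilin'_apply'] at h
    rw [Matrix.mul_assoc]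
    simp only [Matrix.submatrix_apply, G12, Matrix.of_apply]
    rw [← h, Matrix.mul_apply]
    simp only [dotProduct, Matrix.mul_apply, Matrix.mulVec, Matrix.transpose_apply]
    rfl
  have hM : (M * A).det ≠ 0 := by
    have h := congrArg Matrix.det hG
    rw [Matrix.det_mul, Matrix.det_submatrix_equiv_self] at h
    intro h0
    rw [h0, zero_mul] at h
    exact G12_det h.symm
  apply Matrix.eq_zero_of_mulVec_eq_zero hM
  ext i
  have h := hu (σ i).1 (σ i).2
  rw [H.symm, Matrix.toBilin'_apply'] at h
  rw [← Matrix.mulVec_mulVec]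
  exact h

lemma prj_zero (H : A2s LA e) (hdet : A.det = 1 ∨ A.det = -1) (v : Fin 24 → ℤ) :
    prj LA e v = 0 := nondeg H hdet _ (H.prj_orth v)

lemma TT_zero (H : A2s LA e) (hdet : A.det = 1 ∨ A.det = -1) (v w : Fin 24 → ℤ) :
    TT LA e v w = 0 := by
  rw [← H.prj_left, prj_zero H hdet]; simp

variable (A e) in
def psi : (Fin 24 → ℤ) →ₗ[ℤ] WN where
  toFun v := fun p => if p.2 = 0 then ((2 * LA v (e p.1 0) + LA v (e p.1 1) : ℤ) : ℚ) / 3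
    else ((LA v (e p.1 0) + 2 * LA v (e p.1 1) : ℤ) : ℚ) / 3
  map_add' v w := by
    ext p
    simp only [map_add, LinearMap.add_apply, Pi.add_apply]
    split_ifs <;> push_cast <;> ring
  map_smul' c v := by
    ext p
    simp only [map_smul, LinearMap.smul_apply, Pi.smul_apply, smul_eq_mul, RingHom.id_apply]
    simp only [zsmul_eq_mul]
    split_ifs <;> push_cast <;> ring

lemma psi_0 (v : Fin 24 → ℤ) (j : Fin 12) :
    psi A e v (j, 0) = ((2 * LA v (e j 0) + LA v (e j 1) : ℤ) : ℚ) / 3 := rfl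

lemma psi_1 (v : Fin 24 → ℤ) (j : Fin 12) :
    psi A e v (j, 1) = ((LA v (e j 0) + 2 * LA v (e j 1) : ℤ) : ℚ) / 3 := rfl

lemma psi_BW (H : A2s LA e) (hdet : A.det = 1 ∨ A.det = -1) (v w : Fin 24 → ℤ) :
    BW (psi A e v) (psi A e w) = ((LA v w : ℤ) : ℚ) := by
  have h := TT_zero H hdet v w
  rw [TT, sub_eq_zero] at h
  have h2 : (3 : ℚ) * ((LA v w : ℤ) : ℚ) = 3 * BW (psi A e v) (psi A e w) := by
    rw [BW_eq, Finset.mul_sum]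
    have := congrArg (Int.cast : ℤ → ℚ) h
    rw [Int.cast_mul, Int.cast_sum] at this
    push_cast at this
    rw [this]
    apply Finset.sum_congr rfl
    intro j _
    simp only [psi_0, psi_1]
    push_cast
    ring
  linarith

lemma psi_e (H : A2s LA e) (j : Fin 12) (k : Fin 2) : psi A e (e j k) = Et j k := by
  ext ⟨i, l⟩
  fin_cases l
  · show psi A e (e j k) (i, 0) = _
    rw [psi_0, H.gram, H.gram, Et, Pi.single_apply]
    by_cases h : j = i
    · subst h; fin_cases k <;> simp
    · have h' : ¬ i = j := fun e => h e.symm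
      simp [h, h']
  · show psi A e (e j k) (i, 1) = _
    rw [psi_1, H.gram, H.gram, Et, Pi.single_apply]
    by_cases h : j = i
    · subst h; fin_cases k <;> simp
    · have h' : ¬ i = j := fun e => h e.symm
      simp [h, h']

variable (A e) in
def wd (v : Fin 24 → ℤ) (j : Fin 12) : ℤ := LA v (e j 1) - LA v (e j 0)

lemma psi_inj (H : A2s LA e) (hdet : A.det = 1 ∨ A.det = -1) : Function.Injective (psi A e) := by
  rw [injective_iff_map_eq_zero]
  intro v hv
  apply nondeg H hdet
  intro j k
  have h := psi_BW H hdet v (e j k)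
  rw [hv, BW_eq] at h
  simp only [Pi.zero_apply] at h
  have h' : ((LA v (e j k) : ℤ) : ℚ) = 0 := by rw [← h]; simp
  exact_mod_cast h'

lemma psi_mod (v : Fin 24 → ℤ) (j : Fin 12) (m : ℤ) (hm : ((wd A e v j : ℤ) : ZMod 3) = m) :
    (∃ k : ℤ, psi A e v (j, 0) - m * 1 / 3 = k) ∧ (∃ k : ℤ, psi A e v (j, 1) - m * 2 / 3 = k) := by
  have : ((wd A e v j - m : ℤ) : ZMod 3) = 0 := by push_cast; rw [hm, sub_self]
  obtain ⟨k, hk⟩ := zmod_dvd this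
  have hk2 : (LA v (e j 1) : ℚ) - LA v (e j 0) - m = 3 * k := by
    rw [wd] at hk; exact_mod_cast hk
  refine ⟨⟨LA v (e j 0) + k, ?_⟩, ⟨LA v (e j 0) + 2 * k, ?_⟩⟩
  · rw [psi_0]; push_cast; linarith
  · rw [psi_1]; push_cast; linarith

variable (A e) in
def Code : Prop := ∀ v j, ((wd A e v j : ℤ) : ZMod 3) =
    ((∑ i : Fin 6, wd A e v (Fin.natAdd 6 i) * gZ i j : ℤ) : ZMod 3)

lemma psi_NL (hw : Code A e) (v : Fin 24 → ℤ) : psi A e v ∈ NL := by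
  set s : Fin 6 → ℤ := fun i => wd A e v (Fin.natAdd 6 i) with hs
  have h1 : ∀ p, ∃ k : ℤ, (psi A e v - ∑ i, s i • wvec i) p = k := by
    rintro ⟨j, k⟩
    have h := psi_mod v j _ (hw v j)
    have e1 : ∀ c : ℚ, ((∑ i : Fin 6, wd A e v (Fin.natAdd 6 i) * gZ i j : ℤ) : ℚ) * c / 3 =
        ∑ i : Fin 6, (s i : ℚ) * (gZ i j * c / 3) := by
      intro c
      push_cast
      rw [Finset.sum_mul, Finset.sum_div]
      apply Finset.sum_congr rfl
      intro i _
      ring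
    simp only [Pi.sub_apply, Finset.sum_apply, Pi.smul_apply]
    simp only [wvec_apply, zsmul_eq_mul]
    rw [e1, e1] at h
    fin_cases k
    · simpa using h.1
    · simpa using h.2
  choose k hk using h1
  have h2 := int_sum _ k hk
  rw [sub_eq_iff_eq_add] at h2
  rw [h2]
  exact Submodule.add_mem _ (Submodule.sum_mem _ fun p _ => Submodule.smul_mem _ _ (Et_NL _ _))
    (Submodule.sum_mem _ fun p _ => Submodule.smul_mem _ _ (wvec_NL _))

lemma wvec_psi (H : A2s LA e) (hdet : A.det = 1 ∨ A.det = -1) (hw : Code A e) (i : Fin 6) :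
    ∃ v, psi A e v = wvec i := by
  set u : Fin 24 → ℤ := ∑ j, gZ i j • (e j 0 + (2 : ℤ) • e j 1) with hu
  have h1 : ∀ v, ∃ k : ℤ, LA v u = 3 * k := by
    intro v
    apply zmod_dvd
    have : LA v u = ∑ j, gZ i j * (- wd A e v j + 3 * LA v (e j 1)) := by
      rw [hu]
      simp only [map_sum, map_smul, map_add, smul_eq_mul, wd]
      apply Finset.sum_congr rfl
      intro j _
      ring
    rw [this]
    push_cast
    rw [show (3 : ZMod 3) = 0 from rfl]
    simp only [zero_mul, add_zero]
    have h2 : ∑ j, (gZ i j : ZMod 3) * -(wd A e v j : ZMod 3) =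
        - ∑ k : Fin 6, (wd A e v (Fin.natAdd 6 k) : ZMod 3) * ((∑ j, gZ i j * gZ k j : ℤ) : ZMod 3) := by
      have h3 : ∀ j, (gZ i j : ZMod 3) * -(wd A e v j : ZMod 3) = (gZ i j : ZMod 3) *
          -((∑ k : Fin 6, wd A e v (Fin.natAdd 6 k) * gZ k j : ℤ) : ZMod 3) := fun j => by
        rw [← hw v j]
      rw [Finset.sum_congr rfl (fun j _ => h3 j)]
      push_cast
      simp only [Finset.mul_sum, ← Finset.sum_neg_distrib]
      rw [Finset.sum_comm]
      apply Finset.sum_congr rfl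
      intro k _
      apply Finset.sum_congr rfl
      intro j _
      ring
    rw [h2]
    simp only [gZ_orth, mul_zero, Finset.sum_const_zero, neg_zero]
  choose n hn using fun k : Fin 24 => h1 (Pi.single k 1)
  have hAu : A.mulVec u = (3 : ℤ) • n := by
    ext k
    have := hn k
    rw [Matrix.toBilin'_apply', single_one_dotProduct] at this
    rw [this]; simp
  have hadj : A.adjugate.mulVec (A.mulVec u) = A.det • u := by
    rw [Matrix.mulVec_mulVec, Matrix.adjugate_mul, Matrix.smul_mulVec, Matrix.one_mulVec]
  have h3 : ∃ v0 : Fin 24 → ℤ, u = (3 : ℤ) • v0 := by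
    refine ⟨A.det • A.adjugate.mulVec n, ?_⟩
    rw [hAu, Matrix.mulVec_smul] at hadj
    rw [smul_comm, hadj, smul_smul]
    rcases hdet with h | h <;> rw [h] <;> simp
  obtain ⟨v0, hv0⟩ := h3
  refine ⟨v0, ?_⟩
  have h4 : psi A e u = (3 : ℤ) • wvec i := by
    rw [hu]
    simp only [map_sum, map_smul, map_add, psi_e H]
    ext ⟨j, k⟩
    simp only [Finset.sum_apply, Pi.smul_apply, wvec_apply]
    have h5 : ∀ c, (Et c 0 + (2 : ℤ) • Et c 1) = EtV c := fun c => by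
      rw [EtV]; norm_num
    simp only [h5, EtV_apply]
    simp
    ring
  rw [hv0, map_smul] at h4
  exact smul_right_injective WN (by norm_num : (3 : ℤ) ≠ 0) h4

lemma psi_range (H : A2s LA e) (hdet : A.det = 1 ∨ A.det = -1) (hw : Code A e) :
    LinearMap.range (psi A e) = NL := by
  apply le_antisymm
  · rintro _ ⟨v, rfl⟩
    exact psi_NL hw v
  · rw [NL, Submodule.span_le]
    rintro _ (⟨j, k, rfl⟩ | ⟨i, rfl⟩)
    · exact ⟨_, psi_e H j k⟩
    · exact wvec_psi H hdet hw i

lemma e_li (H : A2s LA e) : LinearIndependent ℤ (fun p : JN => e p.1 p.2) := by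
  apply LinearIndependent.of_comp (psi A e)
  have h : (psi A e) ∘ (fun p : JN => e p.1 p.2) = fun p => Pi.basisFun ℚ JN p := by
    ext p : 1
    simp only [Function.comp_apply, psi_e H, Et, Pi.basisFun_apply]
  rw [h]
  exact (Pi.basisFun ℚ JN).linearIndependent.restrict_scalars (by intro a b h; simpa using h)

lemma root_span (H : A2s LA e) (hdet : A.det = 1 ∨ A.det = -1) (hw : Code A e) (v : Fin 24 → ℤ)
    (hv : LA v v = 2) : v ∈ Submodule.span ℤ (Set.range (fun p : JN => e p.1 p.2)) := by
  have h := TT_zero H hdet v v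
  rw [TT, hv, sub_eq_zero] at h
  set q : Fin 12 → ℤ := fun j => LA v (e j 0) ^ 2 + LA v (e j 0) * LA v (e j 1) + LA v (e j 1) ^ 2
    with hq
  have hsum : ∑ j, q j = 3 := by
    have : ∑ j, 2 * q j = 3 * 2 := by
      rw [h]
      apply Finset.sum_congr rfl
      intro j _
      simp only [hq]; ring
    rw [← Finset.mul_sum] at this
    omega
  have hq0 : ∀ j, 0 ≤ q j := fun j => by
    simp only [hq]
    nlinarith [sq_nonneg (LA v (e j 0) + LA v (e j 1)), sq_nonneg (LA v (e j 0)), sq_nonneg (LA v (e j 1))]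
  have hq1 : ∀ j, ((wd A e v j : ℤ) : ZMod 3) ≠ 0 → 1 ≤ q j := by
    intro j hj
    by_contra hlt
    have h0 : q j = 0 := by have := hq0 j; omega
    simp only [hq] at h0
    have a0 : LA v (e j 0) = 0 := by
      nlinarith [sq_nonneg (LA v (e j 0) + 2 * LA v (e j 1)), sq_nonneg (LA v (e j 0))]
    have a1 : LA v (e j 1) = 0 := by
      rw [a0] at h0; simpa using h0
    apply hj
    rw [wd, a0, a1]; simp
  have hcard : (Finset.univ.filter (fun j : Fin 12 => ((wd A e v j : ℤ) : ZMod 3) ≠ 0)).card ≤ 3 := by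
    have h1 : (((Finset.univ.filter (fun j : Fin 12 => ((wd A e v j : ℤ) : ZMod 3) ≠ 0)).card : ℕ) : ℤ)
        ≤ ∑ j, q j := by
      rw [Finset.card_eq_sum_ones, Finset.sum_filter]
      push_cast
      apply Finset.sum_le_sum
      intro j _
      split_ifs with hj
      · exact hq1 j hj
      · exact hq0 j
    omega
  have hzero : ∀ j, ((wd A e v j : ℤ) : ZMod 3) = 0 := by
    have hcode : ∀ j, ((wd A e v j : ℤ) : ZMod 3) =
        (wd A e v (Fin.natAdd 6 (0 : Fin 6)) : ZMod 3) * gZ 0 j + (wd A e v (Fin.natAdd 6 (1 : Fin 6)) : ZMod 3) * gZ 1 j +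
        (wd A e v (Fin.natAdd 6 (2 : Fin 6)) : ZMod 3) * gZ 2 j + (wd A e v (Fin.natAdd 6 (3 : Fin 6)) : ZMod 3) * gZ 3 j +
        (wd A e v (Fin.natAdd 6 (4 : Fin 6)) : ZMod 3) * gZ 4 j + (wd A e v (Fin.natAdd 6 (5 : Fin 6)) : ZMod 3) * gZ 5 j := by
      intro j
      rw [hw v j, Fin.sum_univ_six]
      push_cast
      rfl
    have := gZ_weight _ _ _ _ _ _ ((Finset.card_le_card
      (fun j hj => Finset.mem_filter.2 ⟨Finset.mem_univ j, by
        rw [hcode j]; exact (Finset.mem_filter.1 hj).2⟩)).trans hcard)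
    obtain ⟨b0, b1, b2, b3, b4, b5⟩ := this
    intro j
    rw [hcode j, b0, b1, b2, b3, b4, b5]
    simp
  have hint : ∀ p, ∃ k : ℤ, psi A e v p = k := by
    rintro ⟨j, k⟩
    have h := psi_mod v j 0 (by rw [hzero j]; simp)
    fin_cases k
    · simpa using h.1
    · simpa using h.2
  choose k hk using hint
  have h2 := int_sum _ k hk
  have h3 : v = ∑ p : JN, k p • e p.1 p.2 := by
    apply psi_inj H hdet
    rw [h2, map_sum]
    simp only [map_smul, psi_e H]
  rw [h3]
  exact Submodule.sum_mem _ fun p _ => Submodule.smul_mem _ _ (Submodule.subset_span ⟨p, rfl⟩)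

end final

def sgP : Fin 12 → F3 ⊕ Fin 3 :=
  ![.inl (2,0), .inl (2,1), .inr 0, .inr 2, .inr 1, .inl (1,2), .inl (0,0), .inl (0,1), .inl (0,2),
    .inl (1,0), .inl (1,1), .inl (2,2)]

def swP : Fin 12 → Bool :=
  ![true, false, false, true, false, false, false, false, true, false, true, false]

lemma sgP_inj : ∀ i j, sgP i = sgP j → i = j := by decide +kernel

def flp (b : Bool) (k : Fin 2) : Fin 2 := if b then 1 - k else k

lemma flp_inj : ∀ b k l, flp b k = flp b l ↔ k = l := by decide +kernel

section asm
variable {A : Matrix (Fin 24) (Fin 24) ℤ} {φ : Plat →ₗ[ℤ] (Fin 24 → ℤ)}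

def eAll (φ : Plat →ₗ[ℤ] (Fin 24 → ℤ)) (e3 : Fin 3 → Fin 2 → (Fin 24 → ℤ)) :
    F3 ⊕ Fin 3 → Fin 2 → (Fin 24 → ℤ)
  | .inl t => ep φ t
  | .inr i => e3 i

def e12 (φ : Plat →ₗ[ℤ] (Fin 24 → ℤ)) (e3 : Fin 3 → Fin 2 → (Fin 24 → ℤ)) (j : Fin 12) (k : Fin 2) :
    Fin 24 → ℤ := eAll φ e3 (sgP j) (flp (swP j) k)

lemma e12_a2 (C : Ctx (Matrix.toBilin' A) φ) (e3 : Fin 3 → Fin 2 → (Fin 24 → ℤ))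
    (h1 : ∀ i j k l, Matrix.toBilin' A (e3 i k) (e3 j l) = if i = j then (if k = l then 2 else -1) else 0)
    (h2 : ∀ i k t l, Matrix.toBilin' A (e3 i k) (ep φ t l) = 0) :
    A2s (Matrix.toBilin' A) (e12 φ e3) where
  symm := C.symm
  gram := by
    have h : ∀ s t k l, Matrix.toBilin' A (eAll φ e3 s k) (eAll φ e3 t l) =
        if s = t then (if k = l then 2 else -1) else 0 := by
      rintro (s | s) (t | t) k l
      · simpa [eAll] using C.a2.gram s t k l
      · simp only [eAll]; rw [C.symm, h2]; simp
      · simp only [eAll]; rw [h2]; simp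
      · simpa [eAll] using h1 s t k l
    intro s t k l
    rw [e12, e12, h]
    by_cases hst : s = t
    · subst hst
      simp only [if_true, flp_inj]
    · rw [if_neg hst, if_neg fun h => hst (sgP_inj _ _ h)]

lemma e12_code (C : Ctx (Matrix.toBilin' A) φ) (e3 : Fin 3 → Fin 2 → (Fin 24 → ℤ))
    (h3 : ∀ v i, ((Matrix.toBilin' A v (e3 i 1) - Matrix.toBilin' A v (e3 i 0) : ℤ) : ZMod 3) =
      bK (cK (Matrix.toBilin' A) φ v) (uK i)) :
    Code A (e12 φ e3) := by
  intro v
  have hq := C.qf v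
  set f := ff (Matrix.toBilin' A) φ v with hf
  have hfw : ∀ t, ((Matrix.toBilin' A v (ep φ t 1) - Matrix.toBilin' A v (ep φ t 0) : ℤ) : ZMod 3) = f t :=
    fun t => rfl
  have hfw' : ∀ t, ((Matrix.toBilin' A v (ep φ t 0) - Matrix.toBilin' A v (ep φ t 1) : ℤ) : ZMod 3) = - f t :=
    fun t => by rw [← hfw]; push_cast; ring
  have h3' : ∀ i, ((Matrix.toBilin' A v (e3 i 0) - Matrix.toBilin' A v (e3 i 1) : ℤ) : ZMod 3) =
      - bK (cK (Matrix.toBilin' A) φ v) (uK i) := fun i => by rw [← h3]; push_cast; ring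
  have w0 : ((wd A (e12 φ e3) v 0 : ℤ) : ZMod 3) = - f (2,0) := hfw' _
  have w1 : ((wd A (e12 φ e3) v 1 : ℤ) : ZMod 3) = f (2,1) := hfw _
  have w2 : ((wd A (e12 φ e3) v 2 : ℤ) : ZMod 3) = bK (qA f, qB f, qC f) (uK 0) := h3 _ _
  have w3 : ((wd A (e12 φ e3) v 3 : ℤ) : ZMod 3) = - bK (qA f, qB f, qC f) (uK 2) := h3' _
  have w4 : ((wd A (e12 φ e3) v 4 : ℤ) : ZMod 3) = bK (qA f, qB f, qC f) (uK 1) := h3 _ _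
  have w5 : ((wd A (e12 φ e3) v 5 : ℤ) : ZMod 3) = f (1,2) := hfw _
  have w6 : ((wd A (e12 φ e3) v 6 : ℤ) : ZMod 3) = f (0,0) := hfw _
  have w7 : ((wd A (e12 φ e3) v 7 : ℤ) : ZMod 3) = f (0,1) := hfw _
  have w8 : ((wd A (e12 φ e3) v 8 : ℤ) : ZMod 3) = - f (0,2) := hfw' _
  have w9 : ((wd A (e12 φ e3) v 9 : ℤ) : ZMod 3) = f (1,0) := hfw _
  have w10 : ((wd A (e12 φ e3) v 10 : ℤ) : ZMod 3) = - f (1,1) := hfw' _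
  have w11 : ((wd A (e12 φ e3) v 11 : ℤ) : ZMod 3) = f (2,2) := hfw _
  have q12 := hq (1,2)
  have q21 := hq (2,1)
  have q22 := hq (2,2)
  have key : ∀ j, ((∑ i : Fin 6, wd A (e12 φ e3) v (Fin.natAdd 6 i) * gZ i j : ℤ) : ZMod 3) =
      f (0,0) * gZ 0 j + f (0,1) * gZ 1 j + - f (0,2) * gZ 2 j + f (1,0) * gZ 3 j +
      - f (1,1) * gZ 4 j + f (2,2) * gZ 5 j := by
    intro j
    rw [Fin.sum_univ_six, ← w6, ← w7, ← w8, ← w9, ← w10, ← w11]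
    push_cast
    rfl
  intro j
  rw [key]
  clear key hfw hfw' h3 h3' hq
  have u0 : uK 0 = (1,0,1) := rfl
  have u1 : uK 1 = (1,1,2) := rfl
  have u2 : uK 2 = (1,2,2) := rfl
  simp only [bK, u0, u1, u2, qA, qB, qC] at w0 w1 w2 w3 w4 w5 q12 q21 q22
  clear_value f
  clear hf
  fin_cases j
  · refine w0.trans ?_
    simp [gZ]
    clear w0 w1 w2 w3 w4 w5 w6 w7 w8 w9 w10 w11
    grind
  · refine w1.trans ?_
    simp [gZ]
    clear w0 w1 w2 w3 w4 w5 w6 w7 w8 w9 w10 w11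
    grind
  · refine w2.trans ?_
    simp [gZ]
    clear w0 w1 w2 w3 w4 w5 w6 w7 w8 w9 w10 w11
    grind
  · refine w3.trans ?_
    simp [gZ]
    clear w0 w1 w2 w3 w4 w5 w6 w7 w8 w9 w10 w11
    grind
  · refine w4.trans ?_
    simp [gZ]
    clear w0 w1 w2 w3 w4 w5 w6 w7 w8 w9 w10 w11
    grind
  · refine w5.trans ?_
    simp [gZ]
    clear w0 w1 w2 w3 w4 w5 w6 w7 w8 w9 w10 w11
    grind
  · refine w6.trans ?_
    simp [gZ]
  · refine w7.trans ?_
    simp [gZ]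
  · refine w8.trans ?_
    simp [gZ]
  · refine w9.trans ?_
    simp [gZ]
  · refine w10.trans ?_
    simp [gZ]
  · refine w11.trans ?_
    simp [gZ]

end asm

open Matrix in
theorem statement11
    -- Γ is an even unimodular positive definite lattice of rank 24,
    -- presented as ℤ²⁴ with Gram matrix A
    (A : Matrix (Fin 24) (Fin 24) ℤ)
    (hsymm : ∀ i j, A i j = A j i)
    (heven : ∀ v : Fin 24 → ℤ, ∃ n : ℤ, v ⬝ᵥ A.mulVec v = 2 * n)
    (hdet : A.det = 1 ∨ A.det = -1)
    (hpos : ∀ v : Fin 24 → ℤ, v ≠ 0 → 0 < v ⬝ᵥ A.mulVec v)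
    -- Γ contains a sublattice isometric to P(−1) ...
    (φ : Plat →ₗ[ℤ] (Fin 24 → ℤ))
    (hinj : Function.Injective φ)
    (hiso : ∀ x y : Plat, ((φ x ⬝ᵥ A.mulVec (φ y) : ℤ) : ℚ) = -BP (x : VP) (y : VP))
    -- ... which is primitive
    (hprim : ∀ (v : Fin 24 → ℤ) (n : ℤ), n ≠ 0 → n • v ∈ LinearMap.range φ →
      v ∈ LinearMap.range φ) :
    -- then the root sublattice of Γ is isometric to the orthogonal direct sum of
    -- twelve copies of the A₂ root lattice ...
    (∃ e : Fin 12 × Fin 2 → (Fin 24 → ℤ),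
      LinearIndependent ℤ e ∧
      Submodule.span ℤ {v : Fin 24 → ℤ | v ⬝ᵥ A.mulVec v = 2} =
        Submodule.span ℤ (Set.range e) ∧
      (∀ p q : Fin 12 × Fin 2,
        e p ⬝ᵥ A.mulVec (e q) =
          if p.1 = q.1 then (if p.2 = q.2 then 2 else -1) else 0)) ∧
    -- ... and consequently Γ is isometric to the Niemeier lattice of type A₂¹²
    (∃ ψ : (Fin 24 → ℤ) →ₗ[ℤ] WN,
      Function.Injective ψ ∧
      LinearMap.range ψ = NL ∧
      (∀ v w : Fin 24 → ℤ, BW (ψ v) (ψ w) = ((v ⬝ᵥ A.mulVec w : ℤ) : ℚ))) := by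
  have hT : A.transpose = A := by ext i j; exact hsymm j i
  have hL : ∀ v w, Matrix.toBilin' A v w = v ⬝ᵥ A.mulVec w := fun v w => Matrix.toBilin'_apply' A v w
  have C : Ctx (Matrix.toBilin' A) φ := {
    symm := fun v w => by
      rw [hL, hL, Matrix.dotProduct_mulVec, dotProduct_comm, ← Matrix.mulVec_transpose, hT]
    pos := fun v hv => by rw [hL]; exact hpos v hv
    even := fun v => by rw [hL]; exact heven v
    iso := fun x y => by rw [hL]; exact hiso x y }
  obtain ⟨b, hb⟩ := exBasis (Module.finrank_fin_fun ℤ) φ hinj hprim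
  have hg1 := gram_unimod A hdet b
  have hg2 := fam_det C b hb
  have hg3 := gd_nonneg C.latH.pf (fun i => b (Sum.inr i))
  have hz : gd (Tq (Matrix.toBilin' A) φ) (fun i => b (Sum.inr i)) = 27 := by
    rcases hg1 with h | h
    · rw [h] at hg2; push_cast at hg2; linarith
    · rw [h] at hg2; push_cast at hg2; linarith
  obtain ⟨e3, h1, h2, h3⟩ := C.extra _ hz
  have H := e12_a2 C e3 h1 h2
  have hw := e12_code C e3 h3
  refine ⟨⟨fun p => e12 φ e3 p.1 p.2, e_li H, ?_, ?_⟩, ⟨psi A (e12 φ e3), psi_inj H hdet,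
    psi_range H hdet hw, ?_⟩⟩
  · apply le_antisymm
    · rw [Submodule.span_le]
      intro v hv
      exact root_span H hdet hw v ((hL v v).trans hv)
    · rw [Submodule.span_le]
      rintro _ ⟨p, rfl⟩
      apply Submodule.subset_span
      show _ = _
      rw [← hL, H.gram]
      simp
  · intro p q
    rw [← hL, H.gram]
  · intro v w
    rw [psi_BW H hdet, hL]
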